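/- Every mass distribution μ on ℝ⁸ admits an equipartition into 28 = 7×2×2 boxes by a collection of 6 parallel hyperplanes and two additional non-parallel hyperplanes: there exist a unit vector u ∈ ℝ⁸, real numbers t_1 < t_2 < ... < t_6, unit vectors v and w, and real numbers s₁, s₂, with u, v, w pairwise non-parallel (no two equal up to sign), such that each of the 28 regions {x : t_i < ⟨x,u⟩ < t_{i+1}} ∩ {x : ⟨x,v⟩ ≶ s₁} ∩ {x : ⟨x,w⟩ ≶ s₂} (for 0 ≤ i ≤ 6, with t_0 = -∞, t_7 = +∞, and all four sign choices) has μ-measure μ(ℝ⁸)/28. -/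

import Mathlib

open MeasureTheory

/-- The open slab between consecutive parallel hyperplanes orthogonal to `u`:
for `0 ≤ i ≤ n`, the region `{x : t i < ⟪x,u⟫ < t (i+1)}`, with the conventions
`t 0 = -∞` and `t (n+1) = +∞` (i.e. the corresponding inequality is dropped). -/
noncomputable def slab {d : ℕ} (u : EuclideanSpace ℝ (Fin d)) (t : ℕ → ℝ) (n i : ℕ) :
    Set (EuclideanSpace ℝ (Fin d)) :=
  {x | (1 ≤ i → t i < (inner ℝ x u : ℝ)) ∧ (i + 1 ≤ n → (inner ℝ x u : ℝ) < t (i + 1))}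

/-- The open halfspace below (`b = true`) or above (`b = false`) the hyperplane
orthogonal to `v` at level `s`. -/
def halfSp {d : ℕ} (v : EuclideanSpace ℝ (Fin d)) (s : ℝ) (b : Bool) :
    Set (EuclideanSpace ℝ (Fin d)) :=
  if b then {x | (inner ℝ x v : ℝ) < s} else {x | s < (inner ℝ x v : ℝ)}


set_option linter.unusedSectionVars false
namespace EqBox
open Matrix

abbrev K := ZMod 2

section abstractPart
variable {V : Type} [Fintype V] [DecidableEq V]

/-- The commutator of the diagonal matrix of `s` with `M` (in characteristic two). -/
def com (M : Matrix V V K) (s : V → K) : Matrix V V K :=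
  diagonal s * M + M * diagonal s

lemma com_apply (M : Matrix V V K) (s : V → K) (p q : V) :
    com M s p q = (s p + s q) * M p q := by
  simp [com, diagonal_mul, mul_diagonal]; ring

lemma K_two (x : K) : x + x = 0 := CharTwo.add_self_eq_zero x

lemma mat_two (A : Matrix V V K) : A + A = 0 := by
  ext i j; simp [K_two]

lemma com_comm (M : Matrix V V K) (hM : M * M = 0) (s : V → K) : M * com M s = com M s * M := by
  simp only [com, mul_add, add_mul]
  rw [← Matrix.mul_assoc M M, hM, Matrix.mul_assoc (diagonal s), hM, Matrix.mul_assoc]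
  simp

/-- The pairing. -/
def S (e ρ z : V → K) (A : Matrix V V K) : K := ∑ p, e p * ρ p * (A *ᵥ z) p

lemma S_add (e ρ z : V → K) (A B : Matrix V V K) : S e ρ z (A + B) = S e ρ z A + S e ρ z B := by
  simp [S, add_mulVec, mul_add, Finset.sum_add_distrib]

lemma S_right (e ρ z : V → K) (M A : Matrix V V K) (hz : M *ᵥ z = 0) : S e ρ z (A * M) = 0 := by
  simp [S, ← mulVec_mulVec, hz]

def Inv {ι : Type} (σ : ι → V → V) (A : Matrix V V K) : Prop := ∀ i p q, A (σ i p) (σ i q) = A p q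

lemma sum_invol (τ : V → V) (h : Function.Involutive τ) (f : V → K) : ∑ p, f (τ p) = ∑ p, f p :=
  Equiv.sum_comp (h.toPerm τ) f

lemma S_left {ι : Type} [Fintype ι] (σ : ι → V → V) (hσ : ∀ i, Function.Involutive (σ i))
    (e ρ z : V → K) (M A : Matrix V V K) (he : ∀ i p, e (σ i p) = e p) (hz : ∀ i p, z (σ i p) = z p)
    (hρ : ∀ p, ∑ i, ρ (σ i p) = 1) (heM : e ᵥ* M = 0) (hM : Inv σ M) (hA : Inv σ A) :
    S e ρ z (M * A) = 0 := by
  set k := A *ᵥ z with hk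
  have hkinv : ∀ i p, k (σ i p) = k p := by
    intro i p
    simp only [hk, mulVec, dotProduct]
    rw [← sum_invol (σ i) (hσ i)]
    simp [hA i, hz]
  have h1 : S e ρ z (M * A) = ∑ p, ∑ m, e p * ρ p * M p m * k m := by
    simp only [S, ← mulVec_mulVec, ← hk]
    refine Finset.sum_congr rfl fun p _ => ?_
    simp [mulVec, dotProduct, Finset.mul_sum, mul_assoc]
  have h2 : ∀ i, ∑ p, ∑ m, e p * ρ p * M p m * k m * ρ (σ i m)
      = ∑ p, ∑ m, e p * ρ (σ i p) * M p m * k m * ρ m := by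
    intro i
    rw [← sum_invol (σ i) (hσ i)]
    refine Finset.sum_congr rfl fun p _ => ?_
    rw [← sum_invol (σ i) (hσ i)]
    refine Finset.sum_congr rfl fun m _ => ?_
    rw [he, hM i, hkinv, hσ i]
  have h3 : ∑ p, ∑ m, e p * ρ p * M p m * k m = ∑ i, ∑ p, ∑ m, e p * ρ p * M p m * k m * ρ (σ i m) := by
    symm
    rw [Finset.sum_comm]
    refine Finset.sum_congr rfl fun p _ => ?_
    rw [Finset.sum_comm]
    refine Finset.sum_congr rfl fun m _ => ?_
    rw [← Finset.mul_sum, hρ, mul_one]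
  rw [h1, h3, Finset.sum_congr rfl fun i _ => h2 i]
  rw [Finset.sum_comm]
  have h4 : ∀ p, ∑ i, ∑ m, e p * ρ (σ i p) * M p m * k m * ρ m = ∑ m, e p * M p m * (k m * ρ m) := by
    intro p
    rw [Finset.sum_comm]
    refine Finset.sum_congr rfl fun m _ => ?_
    have : ∀ i, e p * ρ (σ i p) * M p m * k m * ρ m = ρ (σ i p) * (e p * M p m * (k m * ρ m)) := by
      intro i; ring
    rw [Finset.sum_congr rfl fun i _ => this i, ← Finset.sum_mul, hρ, one_mul]
  rw [Finset.sum_congr rfl fun p _ => h4 p, Finset.sum_comm]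
  refine Finset.sum_eq_zero fun m _ => ?_
  rw [← Finset.sum_mul]
  have := congrFun heM m
  simp only [vecMul, dotProduct, Pi.zero_apply] at this
  rw [this, zero_mul]

lemma Inv.mul {ι : Type} {σ : ι → V → V} (hσ : ∀ i, Function.Involutive (σ i))
    {A B : Matrix V V K} (hA : Inv σ A) (hB : Inv σ B) : Inv σ (A * B) := by
  intro i p q
  rw [mul_apply, mul_apply, ← sum_invol (σ i) (hσ i)]
  simp [hA i, hB i]

lemma Inv.com {ι : Type} {σ : ι → V → V} {M : Matrix V V K} (hM : Inv σ M) (s : V → K)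
    (hs : ∀ i, ∃ c, ∀ p, s (σ i p) = s p + c) : Inv σ (com M s) := by
  intro i p q
  obtain ⟨c, hc⟩ := hs i
  rw [com_apply, com_apply, hM i, hc, hc]
  congr 1
  linear_combination K_two c

lemma S_change {ι J : Type} [Fintype ι] (σ : ι → V → V) (hσ : ∀ i, Function.Involutive (σ i))
    (e ρ z : V → K) (M : Matrix V V K) (he : ∀ i p, e (σ i p) = e p) (hz : ∀ i p, z (σ i p) = z p)
    (hρ : ∀ p, ∑ i, ρ (σ i p) = 1) (heM : e ᵥ* M = 0) (hMz : M *ᵥ z = 0) (hMM : M * M = 0)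
    (hM : Inv σ M) (s s' : J → V → K) (c : ι → J → K)
    (hs : ∀ i j p, s j (σ i p) = s j p + c i j) (hs' : ∀ i j p, s' j (σ i p) = s' j p + c i j)
    (l : List J) : ∀ L : Matrix V V K, Inv σ L → M * L = L * M →
      S e ρ z (L * (l.map fun j => com M (s j)).prod) =
      S e ρ z (L * (l.map fun j => com M (s' j)).prod) := by
  induction l with
  | nil => intro L _ _; rfl
  | cons j l ih =>
    intro L hL hLM
    have key : S e ρ z (L * com M (s j) * (l.map fun j => com M (s j)).prod)
        = S e ρ z (L * com M (s' j) * (l.map fun j => com M (s j)).prod) := by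
      have hR : ∀ l : List J, M * (l.map fun j => com M (s j)).prod = (l.map fun j => com M (s j)).prod * M
          ∧ Inv σ (l.map fun j => com M (s j)).prod := by
        intro l
        induction l with
        | nil =>
          refine ⟨by simp, ?_⟩
          intro i p q
          simp [Matrix.one_apply, (hσ i).injective.eq_iff]
        | cons j l ih =>
          simp only [List.map_cons, List.prod_cons]
          refine ⟨?_, ?_⟩
          · rw [← Matrix.mul_assoc, com_comm M hMM, Matrix.mul_assoc, ih.1, Matrix.mul_assoc]
          · exact Inv.mul hσ (Inv.com hM _ fun i => ⟨_, hs i j⟩) ih.2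
      obtain ⟨hR1, hR2⟩ := hR l
      set R := (l.map fun j => com M (s j)).prod
      set h : V → K := fun p => s j p + s' j p with hh
      have hD : com M (s j) = com M (s' j) + com M h := by
        ext p q
        rw [Matrix.add_apply, com_apply, com_apply, com_apply, ← add_mul]
        congr 1
        simp only [hh]
        linear_combination (-1 : K) * K_two (s' j p) - K_two (s' j q)
      have hH : Inv σ (diagonal h) := by
        intro i p q
        rw [diagonal_apply, diagonal_apply]
        simp only [(hσ i).injective.eq_iff, hh, hs, hs']
        split_ifs
        · linear_combination K_two (c i j)
        · rfl
      rw [hD, mul_add, add_mul, S_add]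
      have : L * com M h * R = (L * diagonal h * R) * M + M * (L * diagonal h * R) := by
        simp only [com, mul_add, add_mul]
        congr 1
        · simp only [Matrix.mul_assoc, hR1]
        · simp only [← Matrix.mul_assoc, hLM]
      rw [this, S_add, S_right _ _ _ _ _ hMz,
        S_left σ hσ e ρ z M _ he hz hρ heM hM (Inv.mul hσ (Inv.mul hσ hL hH) hR2)]
      simp
    simp only [List.map_cons, List.prod_cons, ← Matrix.mul_assoc]
    rw [key]
    apply ih
    · exact Inv.mul hσ hL (Inv.com hM _ fun i => ⟨_, hs' i j⟩)
    · rw [← Matrix.mul_assoc, hLM, Matrix.mul_assoc, com_comm M hMM, Matrix.mul_assoc]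

/-- The label argument: the product of commutators vanishes. -/
lemma prod_zero (M : Matrix V V K) (N : ℕ) (s : ℕ → V → K) (lab : V → ℕ) (hlab : ∀ p, lab p < N)
    (hmono : ∀ p q, M p q ≠ 0 → lab p ≤ lab q)
    (hs : ∀ p q j, M p q ≠ 0 → lab p = j → lab q = j → s j p = s j q) :
    ((List.range N).map fun j => com M (s j)).prod = 0 := by
  have key : ∀ n k, k + n = N → ∀ p q, ((List.range' k n).map fun j => com M (s j)).prod p q ≠ 0 →
      lab p < k := by
    intro n
    induction n with
    | zero => intro k hk p q _; simp at hk; rw [hk]; exact hlab p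
    | succ n ih =>
      intro k hk p q h
      rw [List.range'_succ, List.map_cons, List.prod_cons, mul_apply] at h
      obtain ⟨m, _, hm⟩ := Finset.exists_ne_zero_of_sum_ne_zero h
      have h1 := left_ne_zero_of_mul hm
      have h2 := right_ne_zero_of_mul hm
      have h3 := ih (k + 1) (by omega) m q h2
      rw [com_apply] at h1
      have h4 := right_ne_zero_of_mul h1
      have h5 := left_ne_zero_of_mul h1
      have h6 := hmono p m h4
      by_contra hcon
      have := hs p m k h4 (by omega) (by omega)
      rw [this, K_two] at h5
      exact h5 rfl
  ext p q
  by_contra hne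
  rw [List.range_eq_range'] at hne
  exact absurd (key N 0 (by simp) p q hne) (by simp)

end abstractPart
end EqBox

set_option linter.unusedSectionVars false
namespace EqBox
open Matrix

section sphere

def InV (d n : ℕ) (p : Fin (d + 1) → ℤ) : Prop :=
  (∀ i, -(2 * n : ℤ) ≤ p i ∧ p i ≤ 2 * n) ∧ ∃ i, p i = 2 * n ∨ p i = -(2 * n : ℤ)

/-- Cells of the boundary of the cube grid. -/
def VS (d n : ℕ) : Type := {p : Fin (d + 1) → ℤ // InV d n p}

noncomputable instance (d n : ℕ) : Fintype (VS d n) := by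
  have : Set.Finite {p : Fin (d + 1) → ℤ | InV d n p} := by
    refine (Set.finite_Icc (fun _ => -(2 * n : ℤ) : Fin (d + 1) → ℤ) (fun _ => 2 * n)).subset ?_
    intro p hp
    exact ⟨fun i => (hp.1 i).1, fun i => (hp.1 i).2⟩
  exact this.fintype

noncomputable instance (d n : ℕ) : DecidableEq (VS d n) := Classical.decEq _

variable {d n : ℕ}

def Cov (p q : Fin (d + 1) → ℤ) : Prop :=
  ∃ i, (∀ j, j ≠ i → p j = q j) ∧ p i % 2 = 0 ∧ (q i = p i + 1 ∨ q i = p i - 1)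

def EvC (p : Fin (d + 1) → ℤ) : ℕ := (Finset.univ.filter fun i => p i % 2 = 0).card

lemma Cov.card {p q : Fin (d + 1) → ℤ} (h : Cov p q) : EvC p = EvC q + 1 := by
  obtain ⟨i, h1, h2, h3⟩ := h
  unfold EvC
  rw [← Finset.card_insert_of_notMem (a := i)]
  · congr 1
    ext j
    simp only [Finset.mem_filter, Finset.mem_univ, true_and, Finset.mem_insert]
    by_cases hj : j = i
    · subst hj; simp [h2]
    · simp [hj, h1 j hj]
  · simp only [Finset.mem_filter, Finset.mem_univ, true_and]
    omega

lemma even_sum (P : (Fin (d + 1) → ℤ) → Prop) [DecidablePred P]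
    (g : (Fin (d + 1) → ℤ) → (Fin (d + 1) → ℤ))
    (hg : ∀ m, InV d n m → P m → InV d n (g m) ∧ P (g m) ∧ g m ≠ m ∧ g (g m) = m) :
    ∑ m : VS d n, (if P m.1 then (1 : K) else 0) = 0 := by
  rw [← Finset.sum_filter]
  refine Finset.sum_involution
    (fun m hm => ⟨g m.1, (hg m.1 m.2 (by simpa using hm)).1⟩) ?_ ?_ ?_ ?_
  · intro a ha; exact K_two 1
  · intro a ha _ h
    exact (hg a.1 a.2 (by simpa using ha)).2.2.1 (congrArg Subtype.val h)
  · intro a ha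
    exact Finset.mem_filter.2 ⟨Finset.mem_univ _, (hg a.1 a.2 (by simpa using ha)).2.1⟩
  · intro a ha
    exact Subtype.ext (hg a.1 a.2 (by simpa using ha)).2.2.2

open Classical in
noncomputable def Mat (d n : ℕ) : Matrix (VS d n) (VS d n) K := fun p q => if Cov p.1 q.1 then 1 else 0

open Classical in
noncomputable def eps (d n : ℕ) : VS d n → K := fun p => if EvC p.1 = d + 1 then 1 else 0

open Classical in
noncomputable def zz (d n : ℕ) : VS d n → K := fun p => if EvC p.1 = 1 then 1 else 0

lemma Mat_sq : Mat d n * Mat d n = 0 := by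
  classical
  ext p q
  rw [mul_apply, Matrix.zero_apply]
  have : ∀ m : VS d n, Mat d n p m * Mat d n m q = if (Cov p.1 m.1 ∧ Cov m.1 q.1) then 1 else 0 := by
    intro m; unfold Mat; split_ifs <;> simp_all
  rw [Finset.sum_congr rfl fun m _ => this m]
  refine even_sum (fun m => Cov p.1 m ∧ Cov m q.1) (fun m j => p.1 j + q.1 j - m j) ?_
  rintro m hm ⟨⟨i, h1, h2, h3⟩, ⟨k, k1, k2, k3⟩⟩
  have hik : i ≠ k := by rintro rfl; omega
  have hi := k1 i hik
  have hk := h1 k hik.symm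
  have hval : ∀ j, (j = i ∧ p.1 j + q.1 j - m j = p.1 j) ∨ (j = k ∧ p.1 j + q.1 j - m j = q.1 j) ∨
      (j ≠ i ∧ j ≠ k ∧ p.1 j + q.1 j - m j = p.1 j ∧ p.1 j = q.1 j) := by
    intro j
    by_cases hji : j = i
    · subst hji; left; omega
    · by_cases hjk : j = k
      · subst hjk; right; left; omega
      · right; right
        have := h1 j hji; have := k1 j hjk
        refine ⟨hji, hjk, ?_, ?_⟩ <;> omega
  refine ⟨⟨?_, ?_⟩, ⟨⟨k, ?_, ?_, ?_⟩, ⟨i, ?_, ?_, ?_⟩⟩, ?_, ?_⟩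
  · intro j
    have := p.2.1 j; have := q.2.1 j
    rcases hval j with h | h | h <;> constructor <;> simp only <;> omega
  · obtain ⟨j, hj⟩ := q.2.2
    have hji : j ≠ i := by rintro rfl; omega
    have hjk : j ≠ k := by rintro rfl; omega
    refine ⟨j, ?_⟩
    have := h1 j hji; have := k1 j hjk
    simp only; omega
  · intro j hj
    rcases hval j with h | h | h
    · simp only; omega
    · exact absurd h.1 hj
    · simp only; omega
  · omega
  · simp only; omega
  · intro j hj
    rcases hval j with h | h | h
    · exact absurd h.1 hj
    · simp only; omega
    · simp only; omega
  · simp only; omega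
  · simp only; omega
  · intro h
    have := congrFun h i
    omega
  · funext j; simp only; omega

lemma eps_Mat : eps d n ᵥ* Mat d n = 0 := by
  classical
  ext q
  simp only [vecMul, dotProduct, Pi.zero_apply]
  have : ∀ m : VS d n, eps d n m * Mat d n m q = if (EvC m.1 = d + 1 ∧ Cov m.1 q.1) then 1 else 0 := by
    intro m; unfold Mat eps; split_ifs <;> simp_all
  rw [Finset.sum_congr rfl fun m _ => this m]
  refine even_sum (fun m => EvC m = d + 1 ∧ Cov m q.1) (fun m j => 2 * q.1 j - m j) ?_
  rintro m hm ⟨h0, h⟩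
  have hc := h.card
  obtain ⟨i, h1, h2, h3⟩ := h
  have hcov : Cov (fun j => 2 * q.1 j - m j) q.1 := by
    refine ⟨i, ?_, ?_, ?_⟩
    · intro j hj; have := h1 j hj; simp only; omega
    · simp only; omega
    · simp only; omega
  refine ⟨⟨?_, ?_⟩, ⟨?_, hcov⟩, ?_, ?_⟩
  · intro j
    have := q.2.1 j
    have := hm.1 j
    by_cases hj : j = i
    · subst hj; simp only; omega
    · have := h1 j hj; simp only; omega
  · obtain ⟨j, hj⟩ := q.2.2
    have hji : j ≠ i := by rintro rfl; omega
    have := h1 j hji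
    exact ⟨j, by simp only; omega⟩
  · have := hcov.card; omega
  · intro h
    have := congrFun h i
    omega
  · funext j; simp only; omega

def bd (n : ℕ) (a : ℤ) : ℤ := if a = 2 * (n : ℤ) then 2 * (n : ℤ) - 1 else - (2 * n : ℤ) + 1

def sw (n : ℕ) (a b : ℤ) : ℤ := if a % 2 = 0 then (if b = a then bd n a else a) else b

lemma Mat_zz : Mat d n *ᵥ zz d n = 0 := by
  classical
  ext p
  simp only [mulVec, dotProduct, Pi.zero_apply]
  have : ∀ m : VS d n, Mat d n p m * zz d n m = if (Cov p.1 m.1 ∧ EvC m.1 = 1) then 1 else 0 := by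
    intro m; unfold Mat zz; split_ifs <;> simp_all
  rw [Finset.sum_congr rfl fun m _ => this m]
  have pre : ∀ q, InV d n q → EvC q = 1 → ∃ k, q k % 2 = 0 ∧ (∀ j, q j % 2 = 0 → j = k) ∧
      (q k = 2 * n ∨ q k = - (2 * n : ℤ)) := by
    intro q hq h
    obtain ⟨k, hk⟩ := Finset.card_eq_one.1 h
    have hk' : ∀ j, q j % 2 = 0 ↔ j = k := by
      intro j
      have := Finset.ext_iff.1 hk j
      simpa using this
    obtain ⟨j, hj⟩ := hq.2
    have : j = k := (hk' j).1 (by omega)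
    subst this
    exact ⟨j, by omega, fun i hi => (hk' i).1 hi, hj⟩
  by_cases hA : ∀ j, p.1 j % 2 = 0 → (p.1 j = 2 * n ∨ p.1 j = -(2 * n : ℤ))
  · refine even_sum (fun m => Cov p.1 m ∧ EvC m = 1) (fun q j => sw n (p.1 j) (q j)) ?_
    rintro q hq ⟨hcov, hev⟩
    have hcard := hcov.card
    obtain ⟨i, h1, h2, h3⟩ := hcov
    obtain ⟨k, k1, k2, k3⟩ := pre q hq hev
    have hik : k ≠ i := by rintro rfl; omega
    have hk := h1 k hik
    have hi := hA i h2
    have hqi := hq.1 i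
    have hodd : ∀ j, j ≠ i → j ≠ k → p.1 j % 2 ≠ 0 := by
      intro j hj hj' h; rw [h1 j hj] at h; exact hj' (k2 j h)
    have hgi : (sw n (p.1 i) (q i)) = p.1 i := by
      unfold sw; rw [if_pos h2, if_neg (by omega)]
    have hgk : (sw n (p.1 k) (q k)) =
        bd n (p.1 k) := by
      unfold sw; rw [if_pos (by omega), if_pos hk.symm]
    have hgk' : bd n (p.1 k) = p.1 k + 1 ∨
        bd n (p.1 k) = p.1 k - 1 := by
      unfold bd; split_ifs <;> omega
    have hgj : ∀ j, j ≠ i → j ≠ k → (sw n (p.1 j) (q j)) = q j := by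
      intro j hj hj'
      unfold sw; rw [if_neg (hodd j hj hj')]
    have hc : Cov p.1 (fun j => sw n (p.1 j) (q j)) := by
      refine ⟨k, ?_, by omega, ?_⟩
      · intro j hj
        by_cases hji : j = i
        · subst hji; simp only [hgi]
        · simp only [hgj j hji hj]; exact h1 j hji
      · simp only [hgk]; exact hgk'
    refine ⟨⟨?_, ⟨i, ?_⟩⟩, ⟨hc, ?_⟩, ?_, ?_⟩
    · intro j
      have := p.2.1 j
      have := hq.1 j
      by_cases hji : j = i
      · subst hji; simp only [hgi]; assumption
      · by_cases hjk : j = k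
        · subst hjk; simp only [hgk]; unfold bd; split_ifs <;> omega
        · simp only [hgj j hji hjk]; assumption
    · simp only [hgi]; exact hi
    · have := hc.card; omega
    · intro h
      have := congrFun h i
      simp only [hgi] at this; omega
    · funext j
      by_cases hji : j = i
      · subst hji
        simp only [hgi]
        unfold sw bd
        simp only [h2, if_true]
        split_ifs <;> omega
      · by_cases hjk : j = k
        · subst hjk; simp only [hgk]
          unfold sw bd
          have : p.1 j % 2 = 0 := by omega
          simp only [this, if_true]
          split_ifs <;> omega
        · simp only [hgj j hji hjk]
  · push Not at hA
    obtain ⟨k0, hk0, hk1⟩ := hA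
    refine even_sum (fun m => Cov p.1 m ∧ EvC m = 1) (fun q j => 2 * p.1 j - q j) ?_
    rintro q hq ⟨hcov, hev⟩
    have hcard := hcov.card
    obtain ⟨i, h1, h2, h3⟩ := hcov
    obtain ⟨k, k1, k2, k3⟩ := pre q hq hev
    have hk0i : k0 = i := by
      by_contra hne
      have h4 := h1 k0 hne
      have := k2 k0 (by omega)
      subst this
      omega
    subst hk0i
    have hik : k ≠ k0 := by rintro rfl; omega
    have hc : Cov p.1 (fun j => 2 * p.1 j - q j) := by
      refine ⟨k0, ?_, h2, ?_⟩
      · intro j hj; have := h1 j hj; simp only; omega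
      · simp only; omega
    refine ⟨⟨?_, ⟨k, ?_⟩⟩, ⟨hc, ?_⟩, ?_, ?_⟩
    · intro j
      have := p.2.1 j
      have := hq.1 j
      by_cases hji : j = k0
      · subst hji; simp only; omega
      · have := h1 j hji
        simp only; omega
    · have := h1 k hik; simp only; omega
    · have := hc.card; omega
    · intro h
      have := congrFun h k0
      omega
    · funext j; simp only; omega

/-- Antipodal map. -/
def ng (p : VS d n) : VS d n := ⟨fun i => - p.1 i, by
  refine ⟨fun i => ?_, ?_⟩
  · have := p.2.1 i; dsimp only; constructor <;> omega
  · obtain ⟨i, hi⟩ := p.2.2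
    exact ⟨i, by dsimp only; omega⟩⟩

lemma ng_invol : Function.Involutive (ng : VS d n → VS d n) := by
  intro p; apply Subtype.ext; funext i; simp [ng]

lemma Cov_ng (p q : VS d n) (h : Cov p.1 q.1) : Cov (ng p).1 (ng q).1 := by
  obtain ⟨i, h1, h2, h3⟩ := h
  refine ⟨i, ?_, ?_, ?_⟩ <;> simp only [ng]
  · intro j hj; rw [h1 j hj]
  · omega
  · omega

lemma Mat_ng (p q : VS d n) : Mat d n (ng p) (ng q) = Mat d n p q := by
  classical
  unfold Mat
  have : Cov (ng p).1 (ng q).1 ↔ Cov p.1 q.1 := by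
    refine ⟨fun h => ?_, Cov_ng p q⟩
    have := Cov_ng _ _ h
    rwa [ng_invol, ng_invol] at this
  simp [this]

lemma EvC_ng (p : VS d n) : EvC (ng p).1 = EvC p.1 := by
  unfold EvC ng
  congr 1
  ext i
  simp only [Finset.mem_filter, Finset.mem_univ, true_and]
  omega

lemma eps_ng (p : VS d n) : eps d n (ng p) = eps d n p := by
  simp [eps, EvC_ng]

lemma zz_ng (p : VS d n) : zz d n (ng p) = zz d n p := by
  simp [zz, EvC_ng]

def IsFirst (p : Fin (d + 1) → ℤ) (i : Fin (d + 1)) : Prop := p i ≠ 0 ∧ ∀ j < i, p j = 0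

lemma exists_first (hn : 1 ≤ n) (p : VS d n) : ∃ i, IsFirst p.1 i := by
  obtain ⟨i, hi⟩ := p.2.2
  have : p.1 i ≠ 0 := by omega
  obtain ⟨j, hj, hmin⟩ := WellFounded.has_min (wellFounded_lt (α := Fin (d + 1))) {i | p.1 i ≠ 0} ⟨i, this⟩
  refine ⟨j, hj, fun k hk => ?_⟩
  by_contra h
  exact hmin k h hk

lemma IsFirst.unique {p : Fin (d + 1) → ℤ} {i j : Fin (d + 1)} (hi : IsFirst p i) (hj : IsFirst p j) :
    i = j := by
  rcases lt_trichotomy i j with h | h | h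
  · exact absurd (hj.2 i h) hi.1
  · exact h
  · exact absurd (hi.2 j h) hj.1

open Classical in
noncomputable def al (p : VS d n) : K := if ∃ i, IsFirst p.1 i ∧ 0 < p.1 i then 0 else 1

lemma al_pos {p : VS d n} {i : Fin (d + 1)} (h : IsFirst p.1 i) (hp : 0 < p.1 i) : al p = 0 := by
  unfold al; rw [if_pos ⟨i, h, hp⟩]

lemma al_neg {p : VS d n} {i : Fin (d + 1)} (h : IsFirst p.1 i) (hp : p.1 i < 0) : al p = 1 := by
  unfold al; rw [if_neg]
  rintro ⟨j, hj, hj'⟩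
  rw [hj.unique h] at hj'; omega

lemma al_ng (hn : 1 ≤ n) (p : VS d n) : al (ng p) = al p + 1 := by
  obtain ⟨i, hi⟩ := exists_first hn p
  have hi' : IsFirst (ng p).1 i := by
    refine ⟨?_, fun j hj => ?_⟩
    · have := hi.1; simp only [ng]; omega
    · have := hi.2 j hj; simp only [ng]; omega
  rcases lt_or_gt_of_ne hi.1 with h | h
  · rw [al_neg hi h, al_pos hi' (by simp only [ng]; omega)]; rfl
  · rw [al_pos hi h, al_neg hi' (by simp only [ng]; omega)]; rfl

lemma flip_key {p q : VS d n} (h : Cov p.1 q.1) (hα : al p ≠ al q) {i i' : Fin (d + 1)}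
    (hi : IsFirst p.1 i) (hi' : IsFirst q.1 i') :
    i' < i ∧ p.1 i' = 0 ∧ (∀ j, j ≠ i' → p.1 j = q.1 j) ∧ q.1 i' = (if al p = 0 then -1 else 1) := by
  obtain ⟨c, h1, h2, h3⟩ := h
  rcases lt_trichotomy c i with hc | hc | hc
  · have hp := hi.2 c hc
    have hq : IsFirst q.1 c := by
      refine ⟨by omega, fun j hj => ?_⟩
      rw [← h1 j hj.ne]; exact hi.2 j (hj.trans hc)
    have := hq.unique hi'
    subst this
    refine ⟨hc, hp, h1, ?_⟩
    rcases lt_or_gt_of_ne hi.1 with h | h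
    · rw [al_neg hi h] at hα ⊢
      have : q.1 c = 1 := by
        by_contra hne
        exact hα (al_neg hq (by omega)).symm
      simpa using this
    · rw [al_pos hi h] at hα ⊢
      have : q.1 c = -1 := by
        by_contra hne
        exact hα (al_pos hq (by omega)).symm
      simpa using this
  · subst hc
    exfalso
    have hq : IsFirst q.1 c := by
      have := hi.1
      refine ⟨by omega, fun j hj => ?_⟩
      rw [← h1 j hj.ne]; exact hi.2 j hj
    rcases lt_or_gt_of_ne hi.1 with h | h
    · exact hα (by rw [al_neg hi h, al_neg hq (by omega)])
    · exact hα (by rw [al_pos hi h, al_pos hq (by omega)])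
  · exfalso
    have hq : IsFirst q.1 i := by
      refine ⟨by rw [← h1 i hc.ne]; exact hi.1, fun j hj => ?_⟩
      rw [← h1 j (hj.trans hc).ne]; exact hi.2 j hj
    have e := h1 i hc.ne
    rcases lt_or_gt_of_ne hi.1 with h | h
    · exact hα (by rw [al_neg hi h, al_neg hq (by omega)])
    · exact hα (by rw [al_pos hi h, al_pos hq (by omega)])

noncomputable def tt (d n : ℕ) : Matrix (VS d n) (VS d n) K := com (Mat d n) al

lemma tt_ne {p q : VS d n} (h : tt d n p q ≠ 0) : Cov p.1 q.1 ∧ al p ≠ al q := by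
  classical
  rw [tt, com_apply] at h
  have h1 := left_ne_zero_of_mul h
  have h2 := right_ne_zero_of_mul h
  refine ⟨?_, ?_⟩
  · by_contra hc; exact h2 (by simp [Mat, hc])
  · intro hc; rw [hc, K_two] at h1; exact h1 rfl

lemma K_cases (x : K) : x = 0 ∨ x = 1 := by
  revert x; decide

lemma tt_eq_one {p q : VS d n} (h : Cov p.1 q.1) (h' : al p ≠ al q) : tt d n p q = 1 := by
  classical
  rw [tt, com_apply]
  have : Mat d n p q = 1 := by simp [Mat, h]
  rw [this, mul_one]
  rcases K_cases (al p) with h1 | h1 <;> rcases K_cases (al q) with h2 | h2 <;> simp_all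

lemma tt_pow_rank (k : ℕ) : ∀ p q : VS d n, (tt d n ^ k) p q ≠ 0 → EvC p.1 = EvC q.1 + k := by
  induction k with
  | zero =>
    intro p q h
    by_cases hpq : p = q
    · subst hpq; rfl
    · simp [hpq] at h
  | succ k ih =>
    intro p q h
    rw [pow_succ', mul_apply] at h
    obtain ⟨m, _, hm⟩ := Finset.exists_ne_zero_of_sum_ne_zero h
    have h1 := (tt_ne (left_ne_zero_of_mul hm)).1.card
    have h2 := ih m q (right_ne_zero_of_mul hm)
    omega

lemma tt_pow_zero : tt d n ^ (d + 1) = 0 := by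
  ext p q
  by_contra h
  have h1 := tt_pow_rank (d + 1) p q h
  have h2 : EvC p.1 ≤ d + 1 := by
    unfold EvC
    refine (Finset.card_filter_le _ _).trans (by simp)
  have h3 : 0 < EvC q.1 := by
    obtain ⟨i, hi⟩ := q.2.2
    exact Finset.card_pos.2 ⟨i, by simp; omega⟩
  omega

lemma yk_zero (hn : 1 ≤ n) (k : ℕ) : ∀ (p : VS d n) (i : Fin (d + 1)), IsFirst p.1 i → (i : ℕ) < k →
    ((tt d n ^ k) *ᵥ zz d n) p = 0 := by
  induction k with
  | zero => intro p i _ h; omega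
  | succ k ih =>
    intro p i hi hk
    rw [pow_succ', ← mulVec_mulVec]
    simp only [mulVec, dotProduct]
    refine Finset.sum_eq_zero fun q _ => ?_
    by_cases ht : tt d n p q = 0
    · rw [ht, zero_mul]
    · obtain ⟨h1, h2⟩ := tt_ne ht
      obtain ⟨i', hi'⟩ := exists_first hn q
      have h3 := (flip_key h1 h2 hi hi').1
      have := ih q i' hi' (by have : (i' : ℕ) < i := h3; omega)
      simp only [mulVec, dotProduct] at this
      rw [this, mul_zero]

lemma yk_one (hn : 1 ≤ n) (k : ℕ) : ∀ (p : VS d n) (i : Fin (d + 1)), IsFirst p.1 i → (i : ℕ) = k →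
    EvC p.1 = k + 1 → ((tt d n ^ k) *ᵥ zz d n) p = 1 := by
  induction k with
  | zero => intro p i _ _ h; simp [zz, h]
  | succ k ih =>
    intro p i hi hk hE
    rw [pow_succ', ← mulVec_mulVec]
    have hkd : k < d + 1 := by have := i.2; omega
    set c : Fin (d + 1) := ⟨k, hkd⟩ with hc
    have hci : c < i := by rw [Fin.lt_def]; simp [hc]; omega
    have hpc : p.1 c = 0 := hi.2 c hci
    set val : ℤ := if al p = 0 then -1 else 1 with hval
    have hval' : val = 1 ∨ val = -1 := by rw [hval]; split_ifs <;> simp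
    have hq0 : InV d n (Function.update p.1 c val) := by
      refine ⟨fun j => ?_, ?_⟩
      · by_cases hj : j = c
        · subst hj; rw [Function.update_self]; omega
        · rw [Function.update_of_ne hj]; exact p.2.1 j
      · obtain ⟨j, hj⟩ := p.2.2
        have : j ≠ c := by rintro rfl; omega
        exact ⟨j, by rwa [Function.update_of_ne this]⟩
    set q0 : VS d n := ⟨_, hq0⟩ with hq0def
    have q0c : q0.1 c = val := by simp [hq0def]
    have q0j : ∀ j, j ≠ c → q0.1 j = p.1 j := fun j hj => by simp [hq0def, hj]
    have hcov : Cov p.1 q0.1 := by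
      refine ⟨c, fun j hj => (q0j j hj).symm, by rw [hpc]; rfl, by omega⟩
    have hfirst : IsFirst q0.1 c := by
      refine ⟨by omega, fun j hj => ?_⟩
      rw [q0j j hj.ne]; exact hi.2 j (hj.trans hci)
    have hal : al p ≠ al q0 := by
      by_cases h : al p = 0
      · have : val = -1 := by rw [hval, if_pos h]
        rw [h, al_neg hfirst (by omega)]; decide
      · have : val = 1 := by rw [hval, if_neg h]
        rw [al_pos hfirst (by omega)]; exact h
    have hE0 : EvC q0.1 = k + 1 := by have := hcov.card; omega
    simp only [mulVec, dotProduct]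
    rw [Finset.sum_eq_single q0]
    · have := ih q0 c hfirst rfl hE0
      simp only [mulVec, dotProduct] at this
      rw [this, tt_eq_one hcov hal, mul_one]
    · intro q _ hq
      by_cases ht : tt d n p q = 0
      · rw [ht, zero_mul]
      obtain ⟨h1, h2⟩ := tt_ne ht
      obtain ⟨i', hi'⟩ := exists_first hn q
      obtain ⟨f1, f2, f3, f4⟩ := flip_key h1 h2 hi hi'
      have f1' : (i' : ℕ) < i := f1
      by_cases hik : (i' : ℕ) < k
      · have := yk_zero hn k q i' hi' hik
        simp only [mulVec, dotProduct] at this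
        rw [this, mul_zero]
      · exfalso
        apply hq
        have : i' = c := by apply Fin.ext; simp [hc]; omega
        subst this
        apply Subtype.ext
        funext j
        by_cases hj : j = c
        · rw [hj, q0c, hval, f4]
        · rw [q0j j hj, f3 j hj]
    · simp

lemma sphere_count (hn : 1 ≤ n) : S (eps d n) (fun p => al p + 1) (zz d n) (tt d n ^ d) = 1 := by
  unfold S
  have hp0 : InV d n (fun j => if j = Fin.last d then 2 * n else 0) := by
    refine ⟨fun j => ?_, ⟨Fin.last d, by simp⟩⟩
    simp only; split_ifs <;> omega
  set p0 : VS d n := ⟨_, hp0⟩ with hp0d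
  have hf : IsFirst p0.1 (Fin.last d) := by
    refine ⟨by simp [hp0d]; omega, fun j hj => by simp [hp0d, hj.ne]⟩
  have hE : EvC p0.1 = d + 1 := by
    unfold EvC
    rw [Finset.filter_true_of_mem]
    · simp
    · intro j _
      simp only [hp0d]; split_ifs <;> omega
  rw [Finset.sum_eq_single p0]
  · dsimp only
    rw [yk_one hn d p0 _ hf rfl hE, al_pos hf (by simp [hp0d]; omega)]
    simp [eps, hE]
  · intro p _ hp
    by_cases h1 : EvC p.1 = d + 1
    swap
    · simp [eps, h1]
    obtain ⟨i, hi⟩ := exists_first hn p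
    by_cases h2 : (i : ℕ) < d
    · rw [yk_zero hn d p i hi h2, mul_zero]
    have hil : i = Fin.last d := by apply Fin.ext; simp; omega
    subst hil
    rcases lt_or_gt_of_ne hi.1 with h | h
    · dsimp only; rw [al_neg hi h, K_two]; simp
    · exfalso
      apply hp
      apply Subtype.ext
      funext j
      obtain ⟨k, hk⟩ := p.2.2
      have hkl : k = Fin.last d := by
        by_contra hne
        have := hi.2 k (lt_of_le_of_ne (Fin.le_last k) hne)
        omega
      subst hkl
      by_cases hj : j = Fin.last d
      · subst hj; simp [hp0d]; omega
      · rw [hi.2 j (lt_of_le_of_ne (Fin.le_last j) hj)]; simp [hp0d, hj]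
  · simp

end sphere
end EqBox

set_option linter.unusedSectionVars false
namespace EqBox
open Matrix
open scoped Kronecker

section pairPart
variable {A B : Type} [Fintype A] [DecidableEq A] [Fintype B] [DecidableEq B]

def pm (M : Matrix A A K) (N : Matrix B B K) : Matrix (A × B) (A × B) K :=
  M ⊗ₖ (1 : Matrix B B K) + (1 : Matrix A A K) ⊗ₖ N

lemma pm_sq (M : Matrix A A K) (N : Matrix B B K) (hM : M * M = 0) (hN : N * N = 0) :
    pm M N * pm M N = 0 := by
  simp only [pm, mul_add, add_mul, ← mul_kronecker_mul, hM, hN, Matrix.one_mul, Matrix.mul_one]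
  simp only [zero_kronecker, kronecker_zero, zero_add, add_zero]
  exact mat_two _

def pv (e : A → K) (f : B → K) : A × B → K := fun p => e p.1 * f p.2

lemma sum_prod_mul (f : A → K) (g : B → K) : ∑ p : A × B, f p.1 * g p.2 = (∑ a, f a) * ∑ b, g b := by
  rw [Fintype.sum_prod_type, Finset.sum_mul_sum]

lemma kron_mulVec (M : Matrix A A K) (N : Matrix B B K) (e : A → K) (f : B → K) :
    (M ⊗ₖ N) *ᵥ pv e f = pv (M *ᵥ e) (N *ᵥ f) := by
  ext ⟨a, b⟩
  simp only [mulVec, dotProduct, pv]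
  rw [← sum_prod_mul]
  refine Finset.sum_congr rfl fun p _ => ?_
  rw [kroneckerMap_apply]
  ring

lemma vecMul_kron (M : Matrix A A K) (N : Matrix B B K) (e : A → K) (f : B → K) :
    pv e f ᵥ* (M ⊗ₖ N) = pv (e ᵥ* M) (f ᵥ* N) := by
  ext ⟨a, b⟩
  simp only [vecMul, dotProduct, pv]
  rw [← sum_prod_mul]
  refine Finset.sum_congr rfl fun p _ => ?_
  rw [kroneckerMap_apply]
  ring

lemma pm_mulVec (M : Matrix A A K) (N : Matrix B B K) (e : A → K) (f : B → K)
    (h : M *ᵥ e = 0) (h' : N *ᵥ f = 0) : pm M N *ᵥ pv e f = 0 := by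
  rw [pm, add_mulVec, kron_mulVec, kron_mulVec, h, h']
  ext p; simp [pv]

lemma pm_vecMul (M : Matrix A A K) (N : Matrix B B K) (e : A → K) (f : B → K)
    (h : e ᵥ* M = 0) (h' : f ᵥ* N = 0) : pv e f ᵥ* pm M N = 0 := by
  rw [pm, vecMul_add, vecMul_kron, vecMul_kron, h, h']
  ext p; simp [pv]

lemma S_kron (e ρ z : A → K) (e' ρ' z' : B → K) (X : Matrix A A K) (Y : Matrix B B K) :
    S (pv e e') (pv ρ ρ') (pv z z') (X ⊗ₖ Y) = S e ρ z X * S e' ρ' z' Y := by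
  unfold S
  rw [kron_mulVec, ← sum_prod_mul]
  refine Finset.sum_congr rfl fun p _ => by simp only [pv]; ring

lemma com_fst (M : Matrix A A K) (N : Matrix B B K) (s : A → K) :
    com (pm M N) (fun p => s p.1) = com M s ⊗ₖ (1 : Matrix B B K) := by
  ext ⟨a, b⟩ ⟨a', b'⟩
  rw [com_apply, kronecker_apply, com_apply]
  simp only [pm, Matrix.add_apply, kronecker_apply]
  by_cases h : a = a'
  · subst h; simp [K_two]
  · simp [Matrix.one_apply_ne h]; ring

lemma com_snd (M : Matrix A A K) (N : Matrix B B K) (s : B → K) :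
    com (pm M N) (fun p => s p.2) = (1 : Matrix A A K) ⊗ₖ com N s := by
  ext ⟨a, b⟩ ⟨a', b'⟩
  rw [com_apply, kronecker_apply, com_apply]
  simp only [pm, Matrix.add_apply, kronecker_apply]
  by_cases h : b = b'
  · subst h; simp [K_two]
  · simp [Matrix.one_apply_ne h]; ring

lemma kron_pow (X : Matrix A A K) (Y : Matrix B B K) (k : ℕ) : (X ⊗ₖ Y) ^ k = (X ^ k) ⊗ₖ (Y ^ k) := by
  induction k with
  | zero => simp
  | succ k ih => rw [pow_succ, ih, ← mul_kronecker_mul, pow_succ, pow_succ]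

end pairPart

lemma ring_key {R : Type} [CommRing R] (x y z : R) (h2 : (2 : R) = 0) (hx : x ^ 8 = 0) (hy : y ^ 9 = 0)
    (hz : z ^ 7 = 0) :
    y ^ 4 * (x + y) ^ 3 * (z ^ 4 * (x + z) ^ 3) * ((y + z) ^ 4 * (x + y + z) ^ 3) = x ^ 7 * (y ^ 8 * z ^ 6) := by
  have e1 : y ^ 4 * z ^ 4 * (y + z) ^ 4 = y ^ 8 * z ^ 4 := by
    linear_combination (y ^ 4 * z) * hz + (2 * y ^ 7 * z ^ 5 + 3 * y ^ 6 * z ^ 6 + 2 * y ^ 5 * z ^ 7) * h2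
  have e2 : y ^ 8 * (x + y) ^ 3 = y ^ 8 * x ^ 3 := by
    linear_combination (3 * x ^ 2 + 3 * x * y + y ^ 2) * hy
  have e3 : y ^ 8 * (x + y + z) ^ 3 = y ^ 8 * (x + z) ^ 3 := by
    linear_combination (3 * (x + z) ^ 2 + 3 * (x + z) * y + y ^ 2) * hy
  have e4 : x ^ 3 * z ^ 4 * (x + z) ^ 6 = x ^ 7 * z ^ 6 := by
    linear_combination (x * z ^ 4 + 6 * z ^ 5) * hx + (7 * x ^ 7 * z ^ 6) * h2 +
      (20 * x ^ 6 + 15 * x ^ 5 * z + 6 * x ^ 4 * z ^ 2 + x ^ 3 * z ^ 3) * hz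
  linear_combination ((x + y) ^ 3 * (x + z) ^ 3 * (x + y + z) ^ 3) * e1 +
    (z ^ 4 * (x + z) ^ 3 * (x + y + z) ^ 3) * e2 + (z ^ 4 * (x + z) ^ 3 * x ^ 3) * e3 + y ^ 8 * e4

lemma mat_key {V : Type} [Fintype V] [DecidableEq V] (X Y Z : Matrix V V K) (hXY : X * Y = Y * X)
    (hXZ : X * Z = Z * X) (hYZ : Y * Z = Z * Y) (hx : X ^ 8 = 0) (hy : Y ^ 9 = 0) (hz : Z ^ 7 = 0) :
    Y ^ 4 * (X + Y) ^ 3 * (Z ^ 4 * (X + Z) ^ 3) * ((Y + Z) ^ 4 * (X + Y + Z) ^ 3) = X ^ 7 * (Y ^ 8 * Z ^ 6) := by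
  have hc : ∀ a ∈ ({X, Y, Z} : Set (Matrix V V K)), ∀ b ∈ ({X, Y, Z} : Set (Matrix V V K)), a * b = b * a := by
    rintro a (rfl | rfl | rfl) b (rfl | rfl | rfl) <;> simp_all
  letI := Algebra.adjoinCommRingOfComm K hc
  let x : Algebra.adjoin K ({X, Y, Z} : Set (Matrix V V K)) := ⟨X, Algebra.subset_adjoin (by simp)⟩
  let y : Algebra.adjoin K ({X, Y, Z} : Set (Matrix V V K)) := ⟨Y, Algebra.subset_adjoin (by simp)⟩
  let z : Algebra.adjoin K ({X, Y, Z} : Set (Matrix V V K)) := ⟨Z, Algebra.subset_adjoin (by simp)⟩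
  have := ring_key x y z (by
      apply Subtype.ext
      have : (2 : Matrix V V K) = 1 + 1 := by norm_num
      change (2 : Matrix V V K) = 0
      rw [this, mat_two])
    (Subtype.ext hx) (Subtype.ext hy) (Subtype.ext hz)
  exact congrArg Subtype.val this

/-- The product complex. -/
abbrev W (n : ℕ) := VS 7 n × (VS 8 n × VS 6 n)

noncomputable def MM (n : ℕ) : Matrix (W n) (W n) K := pm (Mat 7 n) (pm (Mat 8 n) (Mat 6 n))

def cng {d n : ℕ} (b : Bool) (p : VS d n) : VS d n := if b then ng p else p

def sig {n : ℕ} (b : Bool × Bool × Bool) (p : W n) : W n := (cng b.1 p.1, cng b.2.1 p.2.1, cng b.2.2 p.2.2)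

def bk (b : Bool) : K := if b then 1 else 0

lemma cng_invol {d n : ℕ} (b : Bool) : Function.Involutive (cng b : VS d n → VS d n) := by
  intro p; cases b
  · rfl
  · exact ng_invol p

lemma al_cng {d n : ℕ} (hn : 1 ≤ n) (b : Bool) (p : VS d n) : al (cng b p) = al p + bk b := by
  cases b
  · simp [cng, bk]
  · simp [cng, bk, al_ng hn]

lemma Mat_cng {d n : ℕ} (b : Bool) (p q : VS d n) : Mat d n (cng b p) (cng b q) = Mat d n p q := by
  cases b
  · rfl
  · exact Mat_ng p q

lemma eps_cng {d n : ℕ} (b : Bool) (p : VS d n) : eps d n (cng b p) = eps d n p := by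
  cases b
  · rfl
  · exact eps_ng p

lemma zz_cng {d n : ℕ} (b : Bool) (p : VS d n) : zz d n (cng b p) = zz d n p := by
  cases b
  · rfl
  · exact zz_ng p

lemma one_cng {d n : ℕ} (b : Bool) (p q : VS d n) :
    (1 : Matrix (VS d n) (VS d n) K) (cng b p) (cng b q) = (1 : Matrix (VS d n) (VS d n) K) p q := by
  simp [Matrix.one_apply, (cng_invol b).injective.eq_iff]

/-- Parities. -/
def chA (j : ℕ) : K := if 4 ≤ j % 7 then 1 else 0
def chB (j : ℕ) : K := if j / 7 = 1 then 0 else 1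
def chC (j : ℕ) : K := if j / 7 = 0 then 0 else 1

lemma one_apply_pair {A B : Type} [DecidableEq A] [DecidableEq B] (a a' : A) (b b' : B) :
    (1 : Matrix (A × B) (A × B) K) (a, b) (a', b') = (1 : Matrix A A K) a a' * (1 : Matrix B B K) b b' := by
  by_cases h : a = a' <;> by_cases h' : b = b' <;> simp [Matrix.one_apply, h, h']

theorem comb_main {n : ℕ} (hn : 1 ≤ n) (s : ℕ → W n → K)
    (hs : ∀ b j p, s j (sig b p) = s j p + (bk b.1 * chA j + bk b.2.1 * chB j + bk b.2.2 * chC j)) :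
    ((List.range 21).map fun j => com (MM n) (s j)).prod ≠ 0 := by
  set e : W n → K := pv (eps 7 n) (pv (eps 8 n) (eps 6 n))
  set z : W n → K := pv (zz 7 n) (pv (zz 8 n) (zz 6 n))
  set ρ : W n → K := pv (fun p => al p + 1) (pv (fun p => al p + 1) (fun p => al p + 1)) with hρ
  set s' : ℕ → W n → K := fun j p => chA j * al p.1 + chB j * al p.2.1 + chC j * al p.2.2 with hs'
  have hσ : ∀ b, Function.Involutive (sig b : W n → W n) := by
    intro b p
    simp only [sig, cng_invol _ _]
  have key := S_change (ι := Bool × Bool × Bool) (J := ℕ) sig hσ e ρ z (MM n)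
    (by intro b p; simp [e, pv, sig, eps_cng]) (by intro b p; simp [z, pv, sig, zz_cng])
    (by
      intro p
      simp only [hρ, pv, sig, Fintype.sum_prod_type, Fintype.sum_bool, al_cng hn, bk, if_true]
      generalize al p.1 = x
      generalize al p.2.1 = y
      generalize al p.2.2 = w
      revert x y w
      decide)
    (pm_vecMul _ _ _ _ eps_Mat (pm_vecMul _ _ _ _ eps_Mat eps_Mat))
    (pm_mulVec _ _ _ _ Mat_zz (pm_mulVec _ _ _ _ Mat_zz Mat_zz))
    (pm_sq _ _ Mat_sq (pm_sq _ _ Mat_sq Mat_sq))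
    (by
      rintro b ⟨p1, p2, p3⟩ ⟨q1, q2, q3⟩
      simp only [MM, pm, sig, Matrix.add_apply, kronecker_apply, one_apply_pair, Mat_cng, one_cng])
    s s' (fun b j => bk b.1 * chA j + bk b.2.1 * chB j + bk b.2.2 * chC j) hs
    (by
      intro b j p
      simp only [hs', sig, al_cng hn]; ring)
    (List.range 21) 1 (by
      intro b p q
      simp [Matrix.one_apply, (hσ b).injective.eq_iff]) (by simp)
  rw [Matrix.one_mul, Matrix.one_mul] at key
  intro h0
  rw [h0] at key
  set X : Matrix (W n) (W n) K := tt 7 n ⊗ₖ 1 with hX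
  set Y : Matrix (W n) (W n) K := 1 ⊗ₖ (tt 8 n ⊗ₖ 1) with hY
  set Z : Matrix (W n) (W n) K := 1 ⊗ₖ (1 ⊗ₖ tt 6 n) with hZ
  have hcom : ∀ j, com (MM n) (s' j) = chA j • X + chB j • Y + chC j • Z := by
    intro j
    have h1 : com (MM n) (fun p => al p.1) = X := com_fst _ _ _
    have h2 : com (MM n) (fun p => al p.2.1) = Y := by
      have := com_snd (Mat 7 n) (pm (Mat 8 n) (Mat 6 n)) (fun p => al p.1)
      rw [com_fst] at this
      exact this
    have h3 : com (MM n) (fun p => al p.2.2) = Z := by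
      have := com_snd (Mat 7 n) (pm (Mat 8 n) (Mat 6 n)) (fun p => al p.2)
      rw [com_snd] at this
      exact this
    ext p q
    simp only [← h1, ← h2, ← h3, Matrix.add_apply, Matrix.smul_apply, com_apply, hs', smul_eq_mul]
    ring
  have hXY : X * Y = Y * X := by simp only [hX, hY, ← mul_kronecker_mul, Matrix.one_mul, Matrix.mul_one]
  have hXZ : X * Z = Z * X := by simp only [hX, hZ, ← mul_kronecker_mul, Matrix.one_mul, Matrix.mul_one]
  have hYZ : Y * Z = Z * Y := by simp only [hY, hZ, ← mul_kronecker_mul, Matrix.one_mul, Matrix.mul_one]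
  have hx : X ^ 8 = 0 := by rw [hX, kron_pow, tt_pow_zero, zero_kronecker]
  have hy : Y ^ 9 = 0 := by rw [hY, kron_pow, kron_pow, tt_pow_zero, zero_kronecker, kronecker_zero]
  have hz : Z ^ 7 = 0 := by rw [hZ, kron_pow, kron_pow, tt_pow_zero, kronecker_zero, kronecker_zero]
  have hprod : ((List.range 21).map fun j => com (MM n) (s' j)).prod =
      Y ^ 4 * (X + Y) ^ 3 * (Z ^ 4 * (X + Z) ^ 3) * ((Y + Z) ^ 4 * (X + Y + Z) ^ 3) := by
    simp only [hcom]
    simp [List.range_succ, chA, chB, chC, pow_succ, Matrix.mul_assoc]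
  have hfin : X ^ 7 * (Y ^ 8 * Z ^ 6) = (tt 7 n ^ 7) ⊗ₖ ((tt 8 n ^ 8) ⊗ₖ (tt 6 n ^ 6)) := by
    simp only [hX, hY, hZ, kron_pow, one_pow, ← mul_kronecker_mul, Matrix.one_mul, Matrix.mul_one]
  rw [hprod, mat_key X Y Z hXY hXZ hYZ hx hy hz, hfin, S_kron, S_kron, sphere_count hn, sphere_count hn,
    sphere_count hn] at key
  simp [S] at key

end EqBox

set_option linter.unusedSectionVars false
namespace EqBox
open Matrix

section cells
variable {d n : ℕ}

/-- The closed cell of the unit sup-norm sphere. -/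
def cell (p : VS d n) : Set (Fin (d + 1) → ℝ) :=
  {x | ‖x‖ = 1 ∧ ∀ i, |2 * (n : ℝ) * x i - p.1 i| ≤ if p.1 i % 2 = 0 then 0 else 1}

lemma cell_mono {p q : VS d n} (h : Cov p.1 q.1) : cell p ⊆ cell q := by
  rintro x ⟨h1, h2⟩
  refine ⟨h1, fun j => ?_⟩
  obtain ⟨i, hi, he, hq⟩ := h
  by_cases hj : j = i
  · subst hj
    have := h2 j
    rw [if_pos he] at this
    have h0 : 2 * (n : ℝ) * x j - p.1 j = 0 := abs_nonpos_iff.1 this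
    have ho : ¬ q.1 j % 2 = 0 := by omega
    rw [if_neg ho]
    rcases hq with hq | hq
    · have : (q.1 j : ℝ) = p.1 j + 1 := by exact_mod_cast hq
      rw [this, abs_le]; constructor <;> linarith
    · have : (q.1 j : ℝ) = p.1 j - 1 := by exact_mod_cast hq
      rw [this, abs_le]; constructor <;> linarith
  · rw [← hi j hj]; exact h2 j

lemma cell_nonempty (hn : 1 ≤ n) (p : VS d n) : (cell p).Nonempty := by
  have hn' : (0 : ℝ) < n := by exact_mod_cast hn
  refine ⟨fun i => p.1 i / (2 * n), ?_, fun i => ?_⟩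
  · apply le_antisymm
    · refine (pi_norm_le_iff_of_nonneg zero_le_one).2 fun i => ?_
      have h := p.2.1 i
      have h1 : -(2 * n : ℝ) ≤ p.1 i := by exact_mod_cast h.1
      have h2 : (p.1 i : ℝ) ≤ 2 * n := by exact_mod_cast h.2
      rw [Real.norm_eq_abs, abs_div, abs_of_pos (by positivity : (0 : ℝ) < 2 * n), div_le_one (by positivity)]
      exact abs_le.2 ⟨h1, h2⟩
    · obtain ⟨i, hi⟩ := p.2.2
      have : |(p.1 i : ℝ)| = 2 * n := by
        rcases hi with hi | hi
        · rw [hi]; push_cast; exact abs_of_pos (by positivity)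
        · rw [hi]; push_cast; rw [abs_neg]; exact abs_of_pos (by positivity)
      refine le_trans ?_ (norm_le_pi_norm _ i)
      rw [Real.norm_eq_abs, abs_div, this, abs_of_pos (by positivity : (0 : ℝ) < 2 * n), div_self (by positivity)]
  · have : 2 * (n : ℝ) * (p.1 i / (2 * n)) - p.1 i = 0 := by field_simp; ring
    simp only [this, abs_zero]
    split_ifs <;> norm_num

lemma cell_ng {p : VS d n} {x : Fin (d + 1) → ℝ} (h : x ∈ cell p) : -x ∈ cell (ng p) := by
  refine ⟨by rw [norm_neg]; exact h.1, fun i => ?_⟩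
  have := h.2 i
  have e : (ng p).1 i = - p.1 i := rfl
  rw [e, Pi.neg_apply, ← abs_neg]
  push_cast
  rw [show (-(2 * (n : ℝ) * -x i - -(p.1 i : ℝ))) = 2 * n * x i - p.1 i by ring]
  refine this.trans (le_of_eq ?_)
  have : (p.1 i % 2 = 0) ↔ ((-p.1 i) % 2 = 0) := by omega
  simp only [this]

lemma cell_dist (hn : 1 ≤ n) {p : VS d n} {x y : Fin (d + 1) → ℝ} (hx : x ∈ cell p) (hy : y ∈ cell p) :
    dist x y ≤ 1 / n := by
  have hn' : (0 : ℝ) < n := by exact_mod_cast hn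
  refine (dist_pi_le_iff (by positivity)).2 fun i => ?_
  have h1 : |2 * (n : ℝ) * x i - p.1 i| ≤ 1 := (hx.2 i).trans (by split_ifs <;> norm_num)
  have h2 : |2 * (n : ℝ) * y i - p.1 i| ≤ 1 := (hy.2 i).trans (by split_ifs <;> norm_num)
  rw [abs_le] at h1 h2
  rw [Real.dist_eq, le_div_iff₀ hn', ← abs_of_pos hn', ← abs_mul, abs_le]
  constructor <;> nlinarith

def csg {d : ℕ} (b : Bool) (x : Fin (d + 1) → ℝ) : Fin (d + 1) → ℝ := if b then -x else x

lemma csg_csg (b : Bool) (x : Fin (d + 1) → ℝ) : csg b (csg b x) = x := by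
  cases b <;> simp [csg]

lemma cell_cng (b : Bool) {p : VS d n} {x : Fin (d + 1) → ℝ} (h : x ∈ cell p) : csg b x ∈ cell (cng b p) := by
  cases b
  · exact h
  · exact cell_ng h

end cells

abbrev XX := (Fin 8 → ℝ) × ((Fin 9 → ℝ) × (Fin 7 → ℝ))

def Sph : Set XX := {x | ‖x.1‖ = 1 ∧ ‖x.2.1‖ = 1 ∧ ‖x.2.2‖ = 1}

def sgx (b : Bool × Bool × Bool) (x : XX) : XX := (csg b.1 x.1, csg b.2.1 x.2.1, csg b.2.2 x.2.2)

lemma sgx_sgx (b : Bool × Bool × Bool) (x : XX) : sgx b (sgx b x) = x := by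
  simp only [sgx, csg_csg]

def par (b : Bool × Bool × Bool) (j : ℕ) : K := bk b.1 * chA j + bk b.2.1 * chB j + bk b.2.2 * chC j

def cw {n : ℕ} (p : W n) : Set XX := {x | x.1 ∈ cell p.1 ∧ x.2.1 ∈ cell p.2.1 ∧ x.2.2 ∈ cell p.2.2}

lemma Mat_cov {d n : ℕ} {p q : VS d n} (h : Mat d n p q ≠ 0) : Cov p.1 q.1 := by
  by_contra hc
  exact h (by simp [Mat, hc])

lemma pm_ne {A B : Type} [DecidableEq A] [DecidableEq B] {M : Matrix A A K} {N : Matrix B B K} {p q : A × B}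
    (h : pm M N p q ≠ 0) : (M p.1 q.1 ≠ 0 ∧ p.2 = q.2) ∨ (p.1 = q.1 ∧ N p.2 q.2 ≠ 0) := by
  by_contra hc
  push Not at hc
  apply h
  rw [pm, Matrix.add_apply, kroneckerMap_apply, kroneckerMap_apply]
  have h1 : M p.1 q.1 * (1 : Matrix B B K) p.2 q.2 = 0 := by
    by_cases hm : M p.1 q.1 = 0
    · rw [hm, zero_mul]
    · rw [Matrix.one_apply_ne (hc.1 hm), mul_zero]
  have h2 : (1 : Matrix A A K) p.1 q.1 * N p.2 q.2 = 0 := by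
    by_cases hm : p.1 = q.1
    · rw [hc.2 hm, mul_zero]
    · rw [Matrix.one_apply_ne hm, zero_mul]
  rw [h1, h2, add_zero]

lemma cw_mono {n : ℕ} {p q : W n} (h : MM n p q ≠ 0) : cw p ⊆ cw q := by
  rintro x ⟨h1, h2, h3⟩
  rcases pm_ne h with ⟨a, b⟩ | ⟨a, b⟩
  · exact ⟨cell_mono (Mat_cov a) h1, b ▸ h2, b ▸ h3⟩
  · rcases pm_ne b with ⟨c, e⟩ | ⟨c, e⟩
    · exact ⟨a ▸ h1, cell_mono (Mat_cov c) h2, e ▸ h3⟩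
    · exact ⟨a ▸ h1, c ▸ h2, cell_mono (Mat_cov e) h3⟩

lemma cw_sig {n : ℕ} (b : Bool × Bool × Bool) {p : W n} {x : XX} (h : x ∈ cw p) : sgx b x ∈ cw (sig b p) :=
  ⟨cell_cng _ h.1, cell_cng _ h.2.1, cell_cng _ h.2.2⟩

lemma cw_sig_iff {n : ℕ} (b : Bool × Bool × Bool) (p : W n) (P : XX → Prop) :
    (∃ x ∈ cw (sig b p), P x) ↔ ∃ x ∈ cw p, P (sgx b x) := by
  constructor
  · rintro ⟨x, hx, hP⟩
    refine ⟨sgx b x, ?_, by rwa [sgx_sgx]⟩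
    have := cw_sig b hx
    have e : sig b (sig b p) = p := by simp only [sig, cng_invol _ _]
    rwa [e] at this
  · rintro ⟨x, hx, hP⟩
    exact ⟨_, cw_sig b hx, hP⟩

lemma cw_dist {n : ℕ} (hn : 1 ≤ n) {p : W n} {x y : XX} (hx : x ∈ cw p) (hy : y ∈ cw p) : dist x y ≤ 1 / n := by
  rw [Prod.dist_eq, Prod.dist_eq]
  exact max_le (cell_dist hn hx.1 hy.1) (max_le (cell_dist hn hx.2.1 hy.2.1) (cell_dist hn hx.2.2 hy.2.2))

lemma cw_nonempty {n : ℕ} (hn : 1 ≤ n) (p : W n) : (cw p).Nonempty := by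
  obtain ⟨x, hx⟩ := cell_nonempty hn p.1
  obtain ⟨y, hy⟩ := cell_nonempty hn p.2.1
  obtain ⟨z, hz⟩ := cell_nonempty hn p.2.2
  exact ⟨(x, y, z), hx, hy, hz⟩

lemma cw_sub {n : ℕ} {p : W n} : cw p ⊆ Sph := fun _ hx => ⟨hx.1.1, hx.2.1.1, hx.2.2.1⟩

lemma Sph_compact : IsCompact Sph := by
  have : Sph = (Metric.sphere (0 : Fin 8 → ℝ) 1) ×ˢ
      ((Metric.sphere (0 : Fin 9 → ℝ) 1) ×ˢ (Metric.sphere (0 : Fin 7 → ℝ) 1)) := by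
    ext x; simp [Sph]
  rw [this]
  exact (isCompact_sphere _ _).prod ((isCompact_sphere _ _).prod (isCompact_sphere _ _))

lemma Sph_nonempty : Sph.Nonempty :=
  ⟨(fun _ => 1, fun _ => 1, fun _ => 1), by simp [Sph, pi_norm_const]⟩

theorem bu_main (F : ℕ → XX → ℝ) (hF : ∀ j, ContinuousOn (F j) Sph)
    (hpar : ∀ b j x, x ∈ Sph → F j (sgx b x) = if par b j = 0 then F j x else - F j x) :
    ∃ x ∈ Sph, ∀ j < 21, F j x = 0 := by
  by_contra hno
  push Not at hno
  -- uniform lower bound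
  obtain ⟨ε, hε, hlow⟩ : ∃ ε > 0, ∀ x ∈ Sph, ∃ j < 21, ε ≤ |F j x| := by
    have hc : ContinuousOn (fun x => ∑ j ∈ Finset.range 21, |F j x|) Sph :=
      continuousOn_finsetSum _ fun j _ => (hF j).abs
    obtain ⟨x0, hx0, hmin⟩ := Sph_compact.exists_isMinOn Sph_nonempty hc
    set m := ∑ j ∈ Finset.range 21, |F j x0| with hm
    have hmpos : 0 < m := by
      obtain ⟨j, hj, hne⟩ := hno x0 hx0
      exact Finset.sum_pos' (fun _ _ => abs_nonneg _) ⟨j, Finset.mem_range.2 hj, abs_pos.2 hne⟩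
    refine ⟨m / 21, by positivity, fun x hx => ?_⟩
    by_contra hcon
    push Not at hcon
    have h1 : m ≤ ∑ j ∈ Finset.range 21, |F j x| := hmin hx
    have h2 : ∑ j ∈ Finset.range 21, |F j x| < ∑ j ∈ Finset.range 21, m / 21 :=
      Finset.sum_lt_sum_of_nonempty (by simp) fun j hj => hcon j (Finset.mem_range.1 hj)
    rw [Finset.sum_const, Finset.card_range, nsmul_eq_mul] at h2
    push_cast at h2
    linarith
  -- fine mesh
  obtain ⟨δ, hδ, hun⟩ : ∃ δ > 0, ∀ j < 21, ∀ x ∈ Sph, ∀ y ∈ Sph, dist x y < δ → |F j x - F j y| < ε := by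
    have hu : ∀ j, ∃ δ > 0, ∀ x ∈ Sph, ∀ y ∈ Sph, dist x y < δ → dist (F j x) (F j y) < ε := fun j =>
      Metric.uniformContinuousOn_iff.1 (Sph_compact.uniformContinuousOn_of_continuous (hF j)) ε hε
    choose D hD hD2 using hu
    refine ⟨(Finset.range 21).inf' (by simp) D, ?_, ?_⟩
    · exact (Finset.lt_inf'_iff _).2 fun j _ => hD j
    · intro j hj x hx y hy h
      exact hD2 j x hx y hy (lt_of_lt_of_le h (Finset.inf'_le _ (Finset.mem_range.2 hj)))
  obtain ⟨m, hm⟩ := exists_nat_one_div_lt hδ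
  set n := m + 1 with hnm
  have hn : 1 ≤ n := by omega
  have hm' : 1 / (n : ℝ) < δ := by rw [hnm]; push_cast; exact hm
  have hboth : ∀ (p : W n) (j : ℕ), j < 21 → (∃ x ∈ cw p, ε ≤ F j x) → (∃ x ∈ cw p, F j x ≤ -ε) → False := by
    rintro p j hj ⟨x, hx, h1⟩ ⟨y, hy, h2⟩
    have := hun j hj x (cw_sub hx) y (cw_sub hy) ((cw_dist hn hx hy).trans_lt hm')
    rw [abs_lt] at this
    linarith [this.2]
  classical
  let P : W n → ℕ → Prop := fun p j => ∃ x ∈ cw p, ε ≤ |F j x|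
  let lab : W n → ℕ := fun p => Nat.findGreatest (P p) 20
  let s : ℕ → W n → K := fun j p => if 21 ≤ j then chA j * al p.1 + chB j * al p.2.1 + chC j * al p.2.2 else
    if ∃ x ∈ cw p, ε ≤ F j x then 0 else if ∃ x ∈ cw p, F j x ≤ -ε then 1 else
    chA j * al p.1 + chB j * al p.2.1 + chC j * al p.2.2
  have hdef : ∀ b j (p : W n), chA j * al (sig b p).1 + chB j * al (sig b p).2.1 + chC j * al (sig b p).2.2 =
      chA j * al p.1 + chB j * al p.2.1 + chC j * al p.2.2 + par b j := by
    intro b j p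
    simp only [sig, al_cng hn, par]; ring
  refine comb_main hn s ?_ (prod_zero (MM n) 21 s lab ?_ ?_ ?_)
  · intro b j p
    change s j (sig b p) = s j p + par b j
    by_cases hj : 21 ≤ j
    · simp only [s, if_pos hj]; exact hdef b j p
    have hj' : j < 21 := by omega
    simp only [s, if_neg hj, hdef]
    rw [cw_sig_iff b p (fun x => ε ≤ F j x), cw_sig_iff b p (fun x => F j x ≤ -ε)]
    rcases K_cases (par b j) with h0 | h1
    · have e1 : (∃ x ∈ cw p, ε ≤ F j (sgx b x)) ↔ ∃ x ∈ cw p, ε ≤ F j x := by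
        refine exists_congr fun x => and_congr_right fun hx => ?_
        rw [hpar b j x (cw_sub hx), if_pos h0]
      have e2 : (∃ x ∈ cw p, F j (sgx b x) ≤ -ε) ↔ ∃ x ∈ cw p, F j x ≤ -ε := by
        refine exists_congr fun x => and_congr_right fun hx => ?_
        rw [hpar b j x (cw_sub hx), if_pos h0]
      rw [h0, add_zero]
      simp only [e1, e2, add_zero]
    · have hne : par b j ≠ 0 := by rw [h1]; decide
      have e1 : (∃ x ∈ cw p, ε ≤ F j (sgx b x)) ↔ ∃ x ∈ cw p, F j x ≤ -ε := by
        refine exists_congr fun x => and_congr_right fun hx => ?_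
        rw [hpar b j x (cw_sub hx), if_neg hne]
        constructor <;> intro h <;> linarith
      have e2 : (∃ x ∈ cw p, F j (sgx b x) ≤ -ε) ↔ ∃ x ∈ cw p, ε ≤ F j x := by
        refine exists_congr fun x => and_congr_right fun hx => ?_
        rw [hpar b j x (cw_sub hx), if_neg hne]
        constructor <;> intro h <;> linarith
      have hb := hboth p j hj'
      rw [h1]
      simp only [e1, e2]
      by_cases q1 : ∃ x ∈ cw p, ε ≤ F j x
      · have q2 : ¬ ∃ x ∈ cw p, F j x ≤ -ε := fun q2 => hb q1 q2
        rw [if_neg q2, if_pos q1, if_pos q1, zero_add]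
      · by_cases q2 : ∃ x ∈ cw p, F j x ≤ -ε
        · rw [if_pos q2, if_neg q1, if_pos q2]; decide
        · rw [if_neg q2, if_neg q1, if_neg q1, if_neg q2]
  · intro p
    have : lab p ≤ 20 := Nat.findGreatest_le 20
    omega
  · intro p q h
    refine Nat.findGreatest_mono_left ?_ 20
    rintro j ⟨x, hx, hj⟩
    exact ⟨x, cw_mono h hx, hj⟩
  · intro p q j h hp _
    have hj : j ≤ 20 := by rw [← hp]; exact Nat.findGreatest_le 20
    have hP : P p j := by
      obtain ⟨x, hx⟩ := cw_nonempty hn p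
      obtain ⟨k, hk, hkx⟩ := hlow x (cw_sub hx)
      rw [← hp]
      exact Nat.findGreatest_spec (P := P p) (m := k) (by omega) ⟨x, hx, hkx⟩
    obtain ⟨x, hx, hxj⟩ := hP
    have hxq := cw_mono h hx
    have hj2 : ¬ 21 ≤ j := by omega
    simp only [s, if_neg hj2]
    rcases le_abs.1 hxj with h1 | h1
    · rw [if_pos ⟨x, hx, h1⟩, if_pos ⟨x, hxq, h1⟩]
    · have h1' : F j x ≤ -ε := by linarith
      rw [if_neg (fun hh => hboth p j (by omega) hh ⟨x, hx, h1'⟩), if_pos ⟨x, hx, h1'⟩,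
        if_neg (fun hh => hboth q j (by omega) hh ⟨x, hxq, h1'⟩), if_pos ⟨x, hxq, h1'⟩]

end EqBox

set_option linter.unusedSectionVars false
namespace EqBox
open Filter Topology

abbrev E8 := EuclideanSpace ℝ (Fin 8)

/-- Step function. -/
noncomputable def st (r : ℝ) : ℝ := if 0 < r then 1 else 0

noncomputable def sg (r : ℝ) : ℝ := st r - st (-r)

lemma st_pos {r : ℝ} (h : 0 < r) : st r = 1 := if_pos h
lemma st_neg {r : ℝ} (h : r ≤ 0) : st r = 0 := if_neg (not_lt.2 h)

lemma st_cont {r : ℝ} (h : r ≠ 0) : ContinuousAt st r := by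
  rcases lt_or_gt_of_ne h with h | h
  · have : st =ᶠ[𝓝 r] fun _ => 0 := by
      filter_upwards [gt_mem_nhds h] with x hx using st_neg hx.le
    exact continuousAt_const.congr this.symm
  · have : st =ᶠ[𝓝 r] fun _ => 1 := by
      filter_upwards [lt_mem_nhds h] with x hx using st_pos hx
    exact continuousAt_const.congr this.symm

lemma sg_cont {r : ℝ} (h : r ≠ 0) : ContinuousAt sg r := by
  have h2 : ContinuousAt (fun x : ℝ => st (-x)) r :=
    ContinuousAt.comp (f := fun x : ℝ => -x) (g := st) (st_cont (neg_ne_zero.2 h)) continuousAt_neg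
  exact (st_cont h).sub h2

lemma sg_neg (r : ℝ) : sg (-r) = - sg r := by simp [sg]

lemma sg_pos {r : ℝ} (h : 0 < r) : sg r = 1 := by
  rw [sg, st_pos h, st_neg (by linarith)]; norm_num

lemma sg_of_neg {r : ℝ} (h : r < 0) : sg r = -1 := by
  rw [sg, st_neg h.le, st_pos (by linarith)]; norm_num

lemma st_abs (r : ℝ) : |st r| ≤ 1 := by
  unfold st; split_ifs <;> norm_num

lemma sg_abs (r : ℝ) : |sg r| ≤ 1 := by
  rcases lt_trichotomy r 0 with h | h | h
  · rw [sg_of_neg h]; norm_num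
  · subst h; simp [sg]
  · rw [sg_pos h]; norm_num

lemma st_meas : Measurable st := by
  unfold st
  exact Measurable.ite measurableSet_Ioi measurable_const measurable_const

lemma sg_meas : Measurable sg := by
  unfold sg
  exact st_meas.sub (st_meas.comp measurable_neg)

lemma null_hyper {μ : Measure E8} (hac : μ ≪ volume) (a : E8) (c : ℝ) (h : a ≠ 0 ∨ c ≠ 0) :
    μ {x | inner ℝ x a = c} = 0 := by
  by_cases ha : a = 0
  · have : {x : E8 | inner ℝ x a = c} = ∅ := by
      ext x
      simp only [ha, inner_zero_right, Set.mem_ofPred_eq, Set.mem_empty_iff_false, iff_false]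
      rcases h with h | h
      · exact absurd ha h
      · exact fun h' => h h'.symm
    rw [this, measure_empty]
  · apply hac
    have hn : (inner ℝ a a : ℝ) ≠ 0 := by rw [inner_self_ne_zero]; exact ha
    set x0 : E8 := (c / inner ℝ a a) • a with hx0
    have hx : inner ℝ x0 a = c := by
      rw [hx0, real_inner_smul_left]; field_simp
    have : {x : E8 | inner ℝ x a = c} = (fun x => x + (-x0)) ⁻¹' ((LinearMap.ker (innerₛₗ ℝ a) : Submodule ℝ E8) : Set E8) := by
      ext x
      simp only [Set.mem_ofPred_eq, Set.mem_preimage, SetLike.mem_coe, LinearMap.mem_ker, innerₛₗ_apply_apply]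
      rw [inner_add_right, inner_neg_right, real_inner_comm x a, real_inner_comm x0 a, hx]
      constructor <;> intro h <;> linarith
    rw [this, measure_preimage_add_right]
    apply Measure.addHaar_submodule
    intro htop
    have : a ∈ (LinearMap.ker (innerₛₗ ℝ a) : Submodule ℝ E8) := by rw [htop]; trivial
    rw [LinearMap.mem_ker, innerₛₗ_apply_apply] at this
    exact hn this

lemma ae_ne {μ : Measure E8} (hac : μ ≪ volume) (a : E8) (c : ℝ) (h : a ≠ 0 ∨ c ≠ 0) :
    ∀ᵐ x ∂μ, inner ℝ x a ≠ c := by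
  rw [ae_iff]
  simpa using null_hyper hac a c h

/-- Continuity of integrals of bounded functions. -/
lemma int_cont {X : Type*} [TopologicalSpace X] [FirstCountableTopology X] {μ : Measure E8} [IsFiniteMeasure μ]
    (φ : X → E8 → ℝ) (p : X) (hm : ∀ q, Measurable (φ q)) (hb : ∀ q x, |φ q x| ≤ 1)
    (hc : ∀ᵐ x ∂μ, ContinuousAt (fun q => φ q x) p) : ContinuousAt (fun q => ∫ x, φ q x ∂μ) p :=
  continuousAt_of_dominated (bound := fun _ => 1) (Eventually.of_forall fun q => (hm q).aestronglyMeasurable)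
    (Eventually.of_forall fun q => Eventually.of_forall fun x => by rw [Real.norm_eq_abs]; exact hb q x)
    (integrable_const _) hc

lemma int_bdd {μ : Measure E8} [IsFiniteMeasure μ] {φ : E8 → ℝ} (hm : Measurable φ) (hb : ∀ x, |φ x| ≤ 1) :
    Integrable φ μ :=
  Integrable.of_bound hm.aestronglyMeasurable 1 (Eventually.of_forall fun x => by rw [Real.norm_eq_abs]; exact hb x)

lemma inner_meas (a : E8) : Measurable fun x : E8 => (inner ℝ x a : ℝ) :=
  (continuous_id.inner continuous_const).measurable

noncomputable def G (μ : Measure E8) (u : E8) (t : ℝ) : ℝ := ∫ x, st (t - inner ℝ x u) ∂μ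

variable {μ : Measure E8} [IsFiniteMeasure μ]

lemma G_meas (u : E8) (t : ℝ) : Measurable fun x : E8 => st (t - inner ℝ x u) :=
  st_meas.comp (measurable_const.sub (inner_meas u))

lemma G_cont (hac : μ ≪ volume) {u : E8} (hu : u ≠ 0) (t : ℝ) :
    ContinuousAt (fun p : E8 × ℝ => G μ p.1 p.2) (u, t) := by
  refine int_cont (fun (p : E8 × ℝ) x => st (p.2 - inner ℝ x p.1)) _ (fun q => G_meas _ _) (fun _ _ => st_abs _) ?_
  filter_upwards [ae_ne hac u t (Or.inl hu)] with x hx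
  refine ContinuousAt.comp (g := st) (f := fun p : E8 × ℝ => p.2 - inner ℝ x p.1) (st_cont ?_) ?_
  · exact fun h => hx (by simp only at h; linarith)
  · exact (continuous_snd.sub (continuous_const.inner continuous_fst)).continuousAt

lemma G_mono (hpos : ∀ U : Set E8, IsOpen U → U.Nonempty → 0 < μ U) {u : E8} (hu : u ≠ 0) :
    StrictMono (G μ u) := by
  intro s t hst
  have hn : (inner ℝ u u : ℝ) ≠ 0 := by rw [inner_self_ne_zero]; exact hu
  set U : Set E8 := {x | s < inner ℝ x u ∧ inner ℝ x u < t} with hU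
  have hci : Continuous fun x : E8 => (inner ℝ x u : ℝ) := continuous_id.inner continuous_const
  have ho : IsOpen U := (isOpen_lt continuous_const hci).inter (isOpen_lt hci continuous_const)
  have hne : U.Nonempty := by
    refine ⟨((s + t) / 2 / inner ℝ u u) • u, ?_⟩
    simp only [hU, Set.mem_ofPred_eq, real_inner_smul_left]
    rw [div_mul_cancel₀ _ hn]
    constructor <;> linarith
  have hp := hpos U ho hne
  have h1 : 0 < ∫ x, U.indicator (fun _ => (1 : ℝ)) x ∂μ := by
    rw [integral_indicator_const _ ho.measurableSet, smul_eq_mul, mul_one]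
    exact ENNReal.toReal_pos hp.ne' (measure_ne_top _ _)
  have h2 : ∫ x, U.indicator (fun _ => (1 : ℝ)) x ∂μ ≤ ∫ x, (st (t - inner ℝ x u) - st (s - inner ℝ x u)) ∂μ := by
    refine integral_mono ((integrable_const 1).indicator ho.measurableSet)
      ((int_bdd (G_meas _ _) fun _ => st_abs _).sub (int_bdd (G_meas _ _) fun _ => st_abs _)) fun x => ?_
    by_cases hx : x ∈ U
    · rw [Set.indicator_of_mem hx, st_pos (by linarith [hx.2]), st_neg (by linarith [hx.1])]; norm_num
    · rw [Set.indicator_of_notMem hx]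
      simp only [st]
      split_ifs <;> first | linarith | norm_num
  rw [integral_sub (int_bdd (G_meas _ _) fun _ => st_abs _) (int_bdd (G_meas _ _) fun _ => st_abs _)] at h2
  unfold G
  linarith

lemma G_top (u : E8) : Tendsto (G μ u) atTop (𝓝 (μ.real Set.univ)) := by
  have : μ.real Set.univ = ∫ _ : E8, (1 : ℝ) ∂μ := by simp
  rw [this]
  refine tendsto_integral_filter_of_dominated_convergence (fun _ => 1)
    (Eventually.of_forall fun t => (G_meas u t).aestronglyMeasurable)
    (Eventually.of_forall fun t => Eventually.of_forall fun x => by rw [Real.norm_eq_abs]; exact st_abs _)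
    (integrable_const _) (Eventually.of_forall fun x => ?_)
  refine tendsto_const_nhds.congr' ?_
  filter_upwards [eventually_gt_atTop (inner ℝ x u : ℝ)] with t ht
  rw [st_pos (by linarith)]

lemma G_bot (u : E8) : Tendsto (G μ u) atBot (𝓝 0) := by
  have : (0 : ℝ) = ∫ _ : E8, (0 : ℝ) ∂μ := by simp
  rw [this]
  refine tendsto_integral_filter_of_dominated_convergence (fun _ => 1)
    (Eventually.of_forall fun t => (G_meas u t).aestronglyMeasurable)
    (Eventually.of_forall fun t => Eventually.of_forall fun x => by rw [Real.norm_eq_abs]; exact st_abs _)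
    (integrable_const _) (Eventually.of_forall fun x => ?_)
  refine tendsto_const_nhds.congr' ?_
  filter_upwards [eventually_lt_atBot (inner ℝ x u : ℝ)] with t ht
  rw [st_neg (by linarith)]

lemma G_neg (hac : μ ≪ volume) {u : E8} (hu : u ≠ 0) (t : ℝ) : G μ (-u) t = μ.real Set.univ - G μ u (-t) := by
  have : μ.real Set.univ = ∫ _ : E8, (1 : ℝ) ∂μ := by simp
  rw [this]
  unfold G
  rw [← integral_sub (integrable_const _) (int_bdd (G_meas _ _) fun _ => st_abs _)]
  refine integral_congr_ae ?_
  filter_upwards [ae_ne hac u (-t) (Or.inl hu)] with x hx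
  rw [inner_neg_right]
  rcases lt_or_gt_of_ne hx with h | h
  · rw [st_neg (by linarith), st_pos (by linarith)]; norm_num
  · rw [st_pos (by linarith), st_neg (by linarith)]; norm_num

/-- Quantiles. -/
noncomputable def T (μ : Measure E8) (u : E8) (k : ℕ) : ℝ :=
  Classical.epsilon fun t => G μ u t = k / 7 * μ.real Set.univ

section

lemma M_pos (hac : μ ≪ volume)
    (hpos : ∀ U : Set E8, IsOpen U → U.Nonempty → 0 < μ U) : 0 < μ.real Set.univ := by
  have := hac
  exact ENNReal.toReal_pos (hpos _ isOpen_univ Set.univ_nonempty).ne' (measure_ne_top _ _)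

lemma T_spec (hac : μ ≪ volume)
    (hpos : ∀ U : Set E8, IsOpen U → U.Nonempty → 0 < μ U) {u : E8} (hu : u ≠ 0) {k : ℕ} (h1 : 1 ≤ k) (h6 : k ≤ 6) :
    G μ u (T μ u k) = k / 7 * μ.real Set.univ := by
  have hM := M_pos hac hpos
  have k1 : (1 : ℝ) ≤ k := by exact_mod_cast h1
  have k6 : (k : ℝ) ≤ 6 := by exact_mod_cast h6
  refine Classical.epsilon_spec (p := fun t => G μ u t = k / 7 * μ.real Set.univ) ?_
  have hc : Continuous (G μ u) := by
    rw [continuous_iff_continuousAt]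
    intro t
    exact ContinuousAt.comp (g := fun p : E8 × ℝ => G μ p.1 p.2) (f := fun t => (u, t)) (G_cont hac hu t)
      (by fun_prop)
  refine mem_range_of_exists_le_of_exists_ge hc ?_ ?_
  · have h0 : (0 : ℝ) < (k : ℝ) / 7 * μ.real Set.univ := by positivity
    obtain ⟨t, ht⟩ := ((G_bot (μ := μ) u).eventually (gt_mem_nhds h0)).exists
    exact ⟨t, le_of_lt ht⟩
  · have h0 : (k : ℝ) / 7 * μ.real Set.univ < μ.real Set.univ := by nlinarith
    obtain ⟨t, ht⟩ := ((G_top (μ := μ) u).eventually (lt_mem_nhds h0)).exists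
    exact ⟨t, le_of_lt ht⟩

lemma T_lt (hac : μ ≪ volume)
    (hpos : ∀ U : Set E8, IsOpen U → U.Nonempty → 0 < μ U) {u : E8} (hu : u ≠ 0) {k l : ℕ} (h1 : 1 ≤ k) (hkl : k < l) (h6 : l ≤ 6) : T μ u k < T μ u l := by
  have hM := M_pos hac hpos
  rw [← (G_mono hpos hu).lt_iff_lt, T_spec hac hpos hu h1 (by omega), T_spec hac hpos hu (by omega) h6]
  have : (k : ℝ) < l := by exact_mod_cast hkl
  nlinarith

lemma T_neg (hac : μ ≪ volume)
    (hpos : ∀ U : Set E8, IsOpen U → U.Nonempty → 0 < μ U) {u : E8} (hu : u ≠ 0) {k : ℕ} (h1 : 1 ≤ k) (h6 : k ≤ 6) : T μ (-u) k = - T μ u (7 - k) := by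
  apply (G_mono hpos (neg_ne_zero.2 hu)).injective
  rw [T_spec hac hpos (neg_ne_zero.2 hu) h1 h6, G_neg hac hu, neg_neg, T_spec hac hpos hu (by omega) (by omega)]
  rw [Nat.cast_sub (by omega)]
  push_cast; ring

lemma T_cont (hac : μ ≪ volume)
    (hpos : ∀ U : Set E8, IsOpen U → U.Nonempty → 0 < μ U) {u : E8} (hu : u ≠ 0) {k : ℕ} (h1 : 1 ≤ k) (h6 : k ≤ 6) : ContinuousAt (fun u => T μ u k) u := by
  rw [Metric.continuousAt_iff']
  intro ε hε
  have hGc : ∀ t, ContinuousAt (fun u => G μ u t) u := fun t =>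
    ContinuousAt.comp (g := fun p : E8 × ℝ => G μ p.1 p.2) (f := fun u => (u, t)) (G_cont hac hu t)
      (by fun_prop)
  have hs := T_spec hac hpos hu h1 h6
  have e1 : G μ u (T μ u k - ε) < k / 7 * μ.real Set.univ := by
    rw [← hs]; exact G_mono hpos hu (by linarith)
  have e2 : k / 7 * μ.real Set.univ < G μ u (T μ u k + ε) := by
    rw [← hs]; exact G_mono hpos hu (by linarith)
  filter_upwards [(hGc _).eventually (gt_mem_nhds e1), (hGc _).eventually (lt_mem_nhds e2),
    isOpen_ne.mem_nhds hu] with u' h1' h2' hu'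
  have hs' := T_spec hac hpos hu' h1 h6
  rw [← hs', (G_mono hpos hu').lt_iff_lt] at h1' h2'
  rw [Real.dist_eq, abs_lt]
  constructor <;> linarith

end

end EqBox

set_option linter.unusedSectionVars false
namespace EqBox
open Filter Topology

noncomputable def uE (x : Fin 8 → ℝ) : E8 := WithLp.toLp 2 x
noncomputable def vE (y : Fin 9 → ℝ) : E8 := WithLp.toLp 2 (fun i : Fin 8 => y i.castSucc)
noncomputable def vc (y : Fin 9 → ℝ) : ℝ := y (Fin.last 8)
noncomputable def wE (z : Fin 7 → ℝ) : E8 :=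
  WithLp.toLp 2 (fun i : Fin 8 => if h : (i : ℕ) < 6 then z ⟨i, by omega⟩ else 0)
noncomputable def wc (z : Fin 7 → ℝ) : ℝ := z (Fin.last 6)

lemma uE_cont : Continuous uE := PiLp.continuous_toLp 2 _
lemma vE_cont : Continuous vE := (PiLp.continuous_toLp 2 _).comp (by fun_prop)
lemma wE_cont : Continuous wE := by
  refine (PiLp.continuous_toLp 2 _).comp (continuous_pi fun i => ?_)
  split_ifs <;> fun_prop
lemma vc_cont : Continuous vc := by unfold vc; fun_prop
lemma wc_cont : Continuous wc := by unfold wc; fun_prop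

lemma uE_ne {x : Fin 8 → ℝ} (h : ‖x‖ = 1) : uE x ≠ 0 := by
  intro h0
  have : x = 0 := by
    funext i
    exact congrFun (congrArg WithLp.ofLp h0) i
  rw [this, norm_zero] at h
  norm_num at h

lemma vE_ne {y : Fin 9 → ℝ} (h : ‖y‖ = 1) : vE y ≠ 0 ∨ vc y ≠ 0 := by
  by_contra hc
  push Not at hc
  have : y = 0 := by
    funext i
    refine Fin.lastCases ?_ (fun i => ?_) i
    · exact hc.2
    · exact congrFun (congrArg WithLp.ofLp hc.1) i
  rw [this, norm_zero] at h
  norm_num at h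

lemma wE_ne {z : Fin 7 → ℝ} (h : ‖z‖ = 1) : wE z ≠ 0 ∨ wc z ≠ 0 := by
  by_contra hc
  push Not at hc
  have : z = 0 := by
    funext i
    refine Fin.lastCases ?_ (fun i => ?_) i
    · exact hc.2
    · have := congrFun (congrArg WithLp.ofLp hc.1) (⟨i, by omega⟩ : Fin 8)
      simp only [wE] at this
      rw [dif_pos i.2] at this
      exact this
  rw [this, norm_zero] at h
  norm_num at h

lemma uE_neg (x : Fin 8 → ℝ) : uE (-x) = - uE x := rfl
lemma vE_neg (x : Fin 9 → ℝ) : vE (-x) = - vE x := rfl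
lemma vc_neg (x : Fin 9 → ℝ) : vc (-x) = - vc x := rfl
lemma wc_neg (x : Fin 7 → ℝ) : wc (-x) = - wc x := rfl
lemma wE_neg (x : Fin 7 → ℝ) : wE (-x) = - wE x := by
  ext i
  simp only [wE, PiLp.neg_apply]
  split_ifs <;> simp

/-- Half-space sign. -/
noncomputable def hs (v : E8) (c : ℝ) (x : E8) : ℝ := sg (c - inner ℝ x v)

lemma hs_meas (v : E8) (c : ℝ) : Measurable (hs v c) := sg_meas.comp (measurable_const.sub (inner_meas v))

lemma hs_neg (v : E8) (c : ℝ) (x : E8) : hs (-v) (-c) x = - hs v c x := by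
  unfold hs
  rw [← sg_neg, inner_neg_right]; congr 1; ring

noncomputable def asl (μ : Measure E8) (u : E8) (i : ℕ) (x : E8) : ℝ :=
  (if 1 ≤ i then st (inner ℝ x u - T μ u i) else 1) * (if i + 1 ≤ 6 then st (T μ u (i + 1) - inner ℝ x u) else 1)

noncomputable def gg (k : ℕ) (v : E8) (c : ℝ) (w : E8) (e : ℝ) (x : E8) : ℝ :=
  (if k = 1 then 1 else hs v c x) * (if k = 0 then 1 else hs w e x)

noncomputable def II (μ : Measure E8) (k i : ℕ) (p : XX) : ℝ :=
  ∫ x, asl μ (uE p.1) i x * gg k (vE p.2.1) (vc p.2.1) (wE p.2.2) (wc p.2.2) x ∂μ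

noncomputable def FF (μ : Measure E8) (j : ℕ) (p : XX) : ℝ :=
  if 4 ≤ j % 7 then II μ (j / 7) (j % 7) p - II μ (j / 7) (6 - j % 7) p
  else II μ (j / 7) (j % 7) p + II μ (j / 7) (6 - j % 7) p

lemma asl_meas (μ : Measure E8) (u : E8) (i : ℕ) : Measurable (asl μ u i) := by
  unfold asl
  refine Measurable.mul ?_ ?_
  · split_ifs
    · exact st_meas.comp ((inner_meas u).sub measurable_const)
    · exact measurable_const
  · split_ifs
    · exact st_meas.comp (measurable_const.sub (inner_meas u))
    · exact measurable_const

lemma gg_meas (k : ℕ) (v : E8) (c : ℝ) (w : E8) (e : ℝ) : Measurable (gg k v c w e) := by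
  unfold gg
  refine Measurable.mul ?_ ?_
  · split_ifs
    · exact measurable_const
    · exact hs_meas _ _
  · split_ifs
    · exact measurable_const
    · exact hs_meas _ _

lemma abs_mul_le {a b : ℝ} (ha : |a| ≤ 1) (hb : |b| ≤ 1) : |a * b| ≤ 1 := by
  rw [abs_mul]; exact mul_le_one₀ ha (abs_nonneg _) hb

lemma asl_abs (μ : Measure E8) (u : E8) (i : ℕ) (x : E8) : |asl μ u i x| ≤ 1 := by
  refine abs_mul_le ?_ ?_
  · split_ifs
    · exact st_abs _
    · norm_num
  · split_ifs
    · exact st_abs _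
    · norm_num

lemma gg_abs (k : ℕ) (v : E8) (c : ℝ) (w : E8) (e : ℝ) (x : E8) : |gg k v c w e x| ≤ 1 := by
  refine abs_mul_le ?_ ?_
  · split_ifs
    · norm_num
    · exact sg_abs _
  · split_ifs
    · norm_num
    · exact sg_abs _

lemma gg_par (b c : Bool) (j : ℕ) (y : Fin 9 → ℝ) (z : Fin 7 → ℝ) (x : E8) :
    gg (j / 7) (vE (csg b y)) (vc (csg b y)) (wE (csg c z)) (wc (csg c z)) x =
      (if bk b * chB j + bk c * chC j = 0 then 1 else -1) * gg (j / 7) (vE y) (vc y) (wE z) (wc z) x := by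
  have k1 : (1 : K) ≠ 0 := by decide
  have k2 : (1 : K) + 1 = 0 := by decide
  unfold gg chB chC
  by_cases h0 : j / 7 = 0
  · cases b <;> cases c <;> simp [h0, csg, bk, vE_neg, vc_neg, wE_neg, wc_neg, hs_neg]
  · by_cases h1 : j / 7 = 1
    · cases b <;> cases c <;> simp [h1, csg, bk, vE_neg, vc_neg, wE_neg, wc_neg, hs_neg]
    · cases b <;> cases c <;> simp [h0, h1, k2, csg, bk, vE_neg, vc_neg, wE_neg, wc_neg, hs_neg]

variable {μ : Measure E8} [IsFiniteMeasure μ]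

lemma ae_T (hac : μ ≪ volume)
    (hpos : ∀ U : Set E8, IsOpen U → U.Nonempty → 0 < μ U) {u : E8} (hu : u ≠ 0) : ∀ᵐ x ∂μ, ∀ k, inner ℝ x u ≠ T μ u k := by
  have := hpos
  rw [ae_all_iff]
  exact fun k => ae_ne hac u _ (Or.inl hu)

lemma II_cont (hac : μ ≪ volume)
    (hpos : ∀ U : Set E8, IsOpen U → U.Nonempty → 0 < μ U) (k : ℕ) {i : ℕ} (hi6 : i ≤ 6) {p : XX} (hp : p ∈ Sph) : ContinuousAt (II μ k i) p := by
  have hu := uE_ne hp.1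
  refine int_cont (fun (p : XX) x => asl μ (uE p.1) i x * gg k (vE p.2.1) (vc p.2.1) (wE p.2.2) (wc p.2.2) x) p
    (fun q => (asl_meas _ _ _).mul (gg_meas _ _ _ _ _)) (fun q x => abs_mul_le (asl_abs _ _ _ _) (gg_abs _ _ _ _ _ _)) ?_
  filter_upwards [ae_T hac hpos hu, ae_ne hac (vE p.2.1) (vc p.2.1) (vE_ne hp.2.1),
    ae_ne hac (wE p.2.2) (wc p.2.2) (wE_ne hp.2.2)] with x h1 h2 h3
  have cu : ContinuousAt (fun q : XX => uE q.1) p := (uE_cont.comp continuous_fst).continuousAt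
  have cin : ContinuousAt (fun q : XX => (inner ℝ x (uE q.1) : ℝ)) p :=
    (continuous_const.inner (uE_cont.comp continuous_fst)).continuousAt
  have cT : ∀ k, 1 ≤ k → k ≤ 6 → ContinuousAt (fun q : XX => T μ (uE q.1) k) p := fun k h1 h6 =>
    ContinuousAt.comp (g := fun u => T μ u k) (f := fun q : XX => uE q.1) (T_cont hac hpos hu h1 h6) cu
  have cv : ContinuousAt (fun q : XX => vc q.2.1 - (inner ℝ x (vE q.2.1) : ℝ)) p :=
    ((vc_cont.comp (continuous_fst.comp continuous_snd)).sub
      (continuous_const.inner (vE_cont.comp (continuous_fst.comp continuous_snd)))).continuousAt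
  have cw' : ContinuousAt (fun q : XX => wc q.2.2 - (inner ℝ x (wE q.2.2) : ℝ)) p :=
    ((wc_cont.comp (continuous_snd.comp continuous_snd)).sub
      (continuous_const.inner (wE_cont.comp (continuous_snd.comp continuous_snd)))).continuousAt
  refine ContinuousAt.mul (ContinuousAt.mul ?_ ?_) (ContinuousAt.mul ?_ ?_)
  · by_cases hi : 1 ≤ i
    · simp only [if_pos hi]
      exact ContinuousAt.comp (g := st) (f := fun q : XX => inner ℝ x (uE q.1) - T μ (uE q.1) i)
        (st_cont (sub_ne_zero.2 (h1 i))) (cin.sub (cT i hi hi6))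
    · simp only [if_neg hi]; exact continuousAt_const
  · by_cases hi : i + 1 ≤ 6
    · simp only [if_pos hi]
      exact ContinuousAt.comp (g := st) (f := fun q : XX => T μ (uE q.1) (i + 1) - inner ℝ x (uE q.1))
        (st_cont (sub_ne_zero.2 (h1 (i + 1)).symm)) ((cT (i + 1) (by omega) hi).sub cin)
    · simp only [if_neg hi]; exact continuousAt_const
  · by_cases hk : k = 1
    · simp only [if_pos hk]; exact continuousAt_const
    · simp only [if_neg hk]
      exact ContinuousAt.comp (g := sg) (f := fun q : XX => vc q.2.1 - (inner ℝ x (vE q.2.1) : ℝ))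
        (sg_cont (sub_ne_zero.2 h2.symm)) cv
  · by_cases hk : k = 0
    · simp only [if_pos hk]; exact continuousAt_const
    · simp only [if_neg hk]
      exact ContinuousAt.comp (g := sg) (f := fun q : XX => wc q.2.2 - (inner ℝ x (wE q.2.2) : ℝ))
        (sg_cont (sub_ne_zero.2 h3.symm)) cw'

lemma FF_cont (hac : μ ≪ volume)
    (hpos : ∀ U : Set E8, IsOpen U → U.Nonempty → 0 < μ U) (j : ℕ) : ContinuousOn (FF μ j) Sph := by
  intro p hp
  apply ContinuousAt.continuousWithinAt
  unfold FF
  have h7 : j % 7 < 7 := Nat.mod_lt _ (by norm_num)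
  split_ifs
  · exact (II_cont hac hpos _ (by omega) hp).sub (II_cont hac hpos _ (by omega) hp)
  · exact (II_cont hac hpos _ (by omega) hp).add (II_cont hac hpos _ (by omega) hp)

lemma asl_neg (hac : μ ≪ volume)
    (hpos : ∀ U : Set E8, IsOpen U → U.Nonempty → 0 < μ U) {u : E8} (hu : u ≠ 0) {i : ℕ} (hi : i ≤ 6) (x : E8) : asl μ (-u) i x = asl μ u (6 - i) x := by
  unfold asl
  rw [mul_comm]
  have e1 : (1 ≤ 6 - i) ↔ i + 1 ≤ 6 := by omega
  have e2 : (6 - i + 1 ≤ 6) ↔ 1 ≤ i := by omega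
  simp only [e1, e2]
  congr 1
  · by_cases h : i + 1 ≤ 6
    · rw [if_pos h, if_pos h, T_neg hac hpos hu (by omega) h, inner_neg_right]
      rw [show 7 - (i + 1) = 6 - i by omega]
      congr 1; ring
    · rw [if_neg h, if_neg h]
  · by_cases h : 1 ≤ i
    · rw [if_pos h, if_pos h, T_neg hac hpos hu h hi, inner_neg_right]
      rw [show 7 - i = 6 - i + 1 by omega]
      congr 1; ring
    · rw [if_neg h, if_neg h]

lemma FF_par (hac : μ ≪ volume)
    (hpos : ∀ U : Set E8, IsOpen U → U.Nonempty → 0 < μ U) (b : Bool × Bool × Bool) (j : ℕ) (p : XX) (hp : p ∈ Sph) :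
    FF μ j (sgx b p) = if par b j = 0 then FF μ j p else - FF μ j p := by
  obtain ⟨b1, b2, b3⟩ := b
  obtain ⟨x, y, z⟩ := p
  have hu : uE x ≠ 0 := uE_ne hp.1
  have h7 : j % 7 < 7 := Nat.mod_lt _ (by norm_num)
  have hI : ∀ i ≤ 6, II μ (j / 7) i (sgx (b1, b2, b3) (x, y, z)) =
      (if bk b2 * chB j + bk b3 * chC j = 0 then 1 else -1) *
        II μ (j / 7) (if b1 then 6 - i else i) (x, y, z) := by
    intro i hi
    unfold II
    simp only [sgx, gg_par]
    rw [← integral_const_mul]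
    refine integral_congr_ae (Eventually.of_forall fun t => ?_)
    cases b1
    · simp [csg]
    · simp only [csg, if_true]
      change asl μ (-uE x) i t * _ = _
      rw [asl_neg hac hpos hu hi]; ring
  have k1 : (1 : K) ≠ 0 := by decide
  unfold FF
  rw [hI _ (by omega), hI _ (by omega)]
  have h66 : 6 - (6 - j % 7) = j % 7 := by omega
  have hpr : par (b1, b2, b3) j = bk b1 * chA j + (bk b2 * chB j + bk b3 * chC j) := by
    simp only [par]; ring
  rw [hpr, h66]
  generalize hq : bk b2 * chB j + bk b3 * chC j = q
  have kk : (1 : K) + 1 = 0 := by decide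
  rcases K_cases q with rfl | rfl
  · by_cases h4 : 4 ≤ j % 7
    · cases b1
      · simp [h4, bk, chA]
      · simp [h4, bk, chA]
    · cases b1
      · simp [h4, bk, chA]
      · simp [h4, bk, chA, add_comm]
  · by_cases h4 : 4 ≤ j % 7
    · cases b1
      · simp [h4, bk, chA]; ring
      · simp [h4, bk, chA, kk]; ring
    · cases b1
      · simp [h4, bk, chA]; ring
      · simp [h4, bk, chA]

lemma exists_zero (hac : μ ≪ volume)
    (hpos : ∀ U : Set E8, IsOpen U → U.Nonempty → 0 < μ U) : ∃ p ∈ Sph, ∀ k < 3, ∀ i ≤ 6, II μ k i p = 0 := by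
  obtain ⟨p, hp, h⟩ := bu_main (FF μ) (FF_cont hac hpos) (FF_par hac hpos)
  refine ⟨p, hp, fun k hk i hi => ?_⟩
  have key : ∀ i ≤ 3, II μ k i p = 0 ∧ II μ k (6 - i) p = 0 := by
    intro i hi
    have a := h (7 * k + i) (by omega)
    have b := h (7 * k + (6 - i)) (by omega)
    unfold FF at a b
    rw [show (7 * k + i) / 7 = k by omega, show (7 * k + i) % 7 = i by omega, if_neg (by omega)] at a
    rw [show (7 * k + (6 - i)) / 7 = k by omega, show (7 * k + (6 - i)) % 7 = 6 - i by omega,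
      show 6 - (6 - i) = i by omega] at b
    by_cases h3 : i = 3
    · subst h3
      norm_num at a b ⊢
      linarith
    · rw [if_pos (by omega)] at b
      constructor <;> linarith
  by_cases h3 : i ≤ 3
  · exact (key i h3).1
  · have := (key (6 - i) (by omega)).2
    rwa [show 6 - (6 - i) = i by omega] at this

end EqBox

set_option linter.unusedSectionVars false
namespace EqBox
open Filter Topology

lemma inner_cont (u : E8) : Continuous fun x : E8 => (inner ℝ x u : ℝ) := continuous_id.inner continuous_const

lemma slab_meas (u : E8) (t : ℕ → ℝ) (n i : ℕ) : MeasurableSet (slab u t n i) := by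
  have h1 : MeasurableSet {x : E8 | 1 ≤ i → t i < (inner ℝ x u : ℝ)} := by
    by_cases h : 1 ≤ i
    · simp only [h, true_imp_iff]; exact measurableSet_lt measurable_const (inner_meas u)
    · simp only [h, false_imp_iff]; exact MeasurableSet.univ
  have h2 : MeasurableSet {x : E8 | i + 1 ≤ n → (inner ℝ x u : ℝ) < t (i + 1)} := by
    by_cases h : i + 1 ≤ n
    · simp only [h, true_imp_iff]; exact measurableSet_lt (inner_meas u) measurable_const
    · simp only [h, false_imp_iff]; exact MeasurableSet.univ
  exact h1.inter h2

lemma halfSp_meas (v : E8) (s : ℝ) (b : Bool) : MeasurableSet (halfSp v s b) := by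
  cases b
  · exact measurableSet_lt measurable_const (inner_meas v)
  · exact measurableSet_lt (inner_meas v) measurable_const

lemma mem_true {v : E8} {s : ℝ} {x : E8} : x ∈ halfSp v s true ↔ inner ℝ x v < s := Iff.rfl
lemma mem_false {v : E8} {s : ℝ} {x : E8} : x ∈ halfSp v s false ↔ s < inner ℝ x v := Iff.rfl

lemma asl_ind (μ : Measure E8) (u : E8) (i : ℕ) (x : E8) :
    asl μ u i x = (slab u (T μ u) 6 i).indicator (fun _ => (1 : ℝ)) x := by
  classical
  have hmem : x ∈ slab u (T μ u) 6 i ↔ (1 ≤ i → T μ u i < (inner ℝ x u : ℝ)) ∧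
    (i + 1 ≤ 6 → (inner ℝ x u : ℝ) < T μ u (i + 1)) := Iff.rfl
  simp only [Set.indicator_apply, hmem]
  unfold asl st
  by_cases h1 : 1 ≤ i <;> by_cases h2 : i + 1 ≤ 6 <;> simp only [h1, h2, if_true, if_false, sub_pos, true_imp_iff, false_imp_iff, true_and, and_true, one_mul, mul_one]
  by_cases h3 : T μ u i < inner ℝ x u <;> simp [h3]

lemma half_ind {v : E8} {c : ℝ} {x : E8} (h : inner ℝ x v ≠ c) (b : Bool) :
    (halfSp v c b).indicator (fun _ => (1 : ℝ)) x = (1 + (if b then 1 else -1) * hs v c x) / 2 := by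
  classical
  rw [Set.indicator_apply]
  unfold hs
  rcases lt_or_gt_of_ne h with h | h
  · rw [sg_pos (by linarith)]
    cases b
    · rw [if_neg (by rw [mem_false]; exact not_lt.2 h.le)]; norm_num
    · rw [if_pos (mem_true.2 h)]; norm_num
  · rw [sg_of_neg (by linarith)]
    cases b
    · rw [if_pos (mem_false.2 h)]; norm_num
    · rw [if_neg (by rw [mem_true]; exact not_lt.2 h.le)]; norm_num

/-- Nonparallelism. -/
lemma nonpar {u v w : E8} {t : ℕ → ℝ} {s₁ s₂ : ℝ} (ht : t 1 < t 6)
    (h : ∀ i ≤ 6, ∀ b₁ b₂ : Bool, (slab u t 6 i ∩ halfSp v s₁ b₁ ∩ halfSp w s₂ b₂).Nonempty) :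
    v ≠ u ∧ v ≠ -u ∧ w ≠ u ∧ w ≠ -u ∧ w ≠ v ∧ w ≠ -v := by
  have lo : ∀ b₁ b₂ : Bool, ∃ x, inner ℝ x u < t 1 ∧ x ∈ halfSp v s₁ b₁ ∧ x ∈ halfSp w s₂ b₂ := by
    intro b₁ b₂
    obtain ⟨x, ⟨h1, h2⟩, h3⟩ := h 0 (by norm_num) b₁ b₂
    exact ⟨x, h1.2 (by norm_num), h2, h3⟩
  have hi : ∀ b₁ b₂ : Bool, ∃ x, t 6 < inner ℝ x u ∧ x ∈ halfSp v s₁ b₁ ∧ x ∈ halfSp w s₂ b₂ := by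
    intro b₁ b₂
    obtain ⟨x, ⟨h1, h2⟩, h3⟩ := h 6 (by norm_num) b₁ b₂
    exact ⟨x, h1.1 (by norm_num), h2, h3⟩
  obtain ⟨a, a1, a2, a3⟩ := lo true true
  obtain ⟨b, b1, b2, b3⟩ := lo false false
  obtain ⟨c, c1, c2, c3⟩ := hi true true
  obtain ⟨d, d1, d2, d3⟩ := hi false false
  obtain ⟨e, e1, e2, e3⟩ := lo true false
  obtain ⟨f, f1, f2, f3⟩ := lo false true
  rw [mem_true] at a2 a3 c2 c3 e2 f3
  rw [mem_false] at b2 b3 d2 d3 e3 f2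
  have iu : ∀ x : E8, (inner ℝ x (-u) : ℝ) = - inner ℝ x u := fun x => inner_neg_right x u
  have iv : ∀ x : E8, (inner ℝ x (-v) : ℝ) = - inner ℝ x v := fun x => inner_neg_right x v
  refine ⟨?_, ?_, ?_, ?_, ?_, ?_⟩ <;> intro hh
  · rw [hh] at b2 c2; linarith
  · rw [hh, iu] at a2 d2; linarith
  · rw [hh] at b3 c3; linarith
  · rw [hh, iu] at a3 d3; linarith
  · rw [hh] at e3 f3; linarith
  · rw [hh, iv] at a3 d3; linarith

/-- Normalization. -/
lemma slab_norm {u : E8} (hu : u ≠ 0) (t : ℕ → ℝ) (n i : ℕ) :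
    slab ((‖u‖⁻¹) • u) (fun k => ‖u‖⁻¹ * t k) n i = slab u t n i := by
  have h : 0 < ‖u‖⁻¹ := inv_pos.2 (norm_pos_iff.2 hu)
  ext x
  simp only [slab, Set.mem_ofPred_eq, real_inner_smul_right, mul_lt_mul_iff_right₀ h]

lemma half_norm {v : E8} (hv : v ≠ 0) (s : ℝ) (b : Bool) :
    halfSp ((‖v‖⁻¹) • v) (‖v‖⁻¹ * s) b = halfSp v s b := by
  have h : 0 < ‖v‖⁻¹ := inv_pos.2 (norm_pos_iff.2 hv)
  ext x
  cases b
  · simp only [mem_false, real_inner_smul_right, mul_lt_mul_iff_right₀ h]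
  · simp only [mem_true, real_inner_smul_right, mul_lt_mul_iff_right₀ h]

lemma norm_one {v : E8} (hv : v ≠ 0) : ‖(‖v‖⁻¹) • v‖ = 1 := by
  rw [norm_smul, norm_inv, norm_norm, inv_mul_cancel₀ (norm_ne_zero_iff.2 hv)]

variable {μ : Measure E8} [IsFiniteMeasure μ]

lemma int_asl (hac : μ ≪ volume)
    (hpos : ∀ U : Set E8, IsOpen U → U.Nonempty → 0 < μ U) {u : E8} (hu : u ≠ 0) {i : ℕ} (hi : i ≤ 6) : ∫ x, asl μ u i x ∂μ = μ.real Set.univ / 7 := by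
  set c : ℕ → E8 → ℝ := fun k x => if k = 0 then 0 else if 7 ≤ k then 1 else st (T μ u k - inner ℝ x u) with hc
  have hci : ∀ k, Integrable (c k) μ := by
    intro k
    by_cases h0 : k = 0
    · simp only [hc, if_pos h0]; exact integrable_const _
    · by_cases h7 : 7 ≤ k
      · simp only [hc, if_neg h0, if_pos h7]; exact integrable_const _
      · simp only [hc, if_neg h0, if_neg h7]; exact int_bdd (G_meas _ _) fun _ => st_abs _
  have hcv : ∀ k ≤ 7, ∫ x, c k x ∂μ = k / 7 * μ.real Set.univ := by
    intro k hk
    by_cases h0 : k = 0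
    · subst h0; simp [hc]
    · by_cases h7 : 7 ≤ k
      · have : k = 7 := by omega
        subst this; simp [hc]
      · simp only [hc, if_neg h0, if_neg h7]
        exact T_spec hac hpos hu (by omega) (by omega)
  have hae : ∀ᵐ x ∂μ, asl μ u i x = c (i + 1) x - c i x := by
    filter_upwards [ae_T hac hpos hu] with x hx
    have n1 : ¬ (i + 1 = 0) := by omega
    simp only [hc, asl, if_neg n1]
    by_cases h0 : i = 0
    · subst h0; simp
    · by_cases h6 : i = 6
      · subst h6
        rcases lt_or_gt_of_ne (hx 6) with h | h
        · norm_num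
          rw [st_neg (by linarith), st_pos (by linarith)]; norm_num
        · norm_num
          rw [st_pos (by linarith), st_neg (by linarith)]; norm_num
      · have hT := T_lt hac hpos hu (k := i) (l := i + 1) (by omega) (by omega) (by omega)
        rw [if_pos (by omega), if_pos (by omega), if_neg (by omega), if_neg h0, if_neg (by omega)]
        rcases lt_or_gt_of_ne (hx i) with h | h
        · rw [st_neg (by linarith : inner ℝ x u - T μ u i ≤ 0), st_pos (by linarith : 0 < T μ u (i + 1) - inner ℝ x u),
            st_pos (by linarith)]; norm_num
        · rw [st_pos (by linarith : 0 < inner ℝ x u - T μ u i), st_neg (by linarith : T μ u i - inner ℝ x u ≤ 0)]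
          ring
  rw [integral_congr_ae hae, integral_sub (hci _) (hci _), hcv _ (by omega), hcv _ (by omega)]
  push_cast; ring

lemma box_meas (hac : μ ≪ volume)
    (hpos : ∀ U : Set E8, IsOpen U → U.Nonempty → 0 < μ U) {u v w : E8} {c e : ℝ} (hu : u ≠ 0) (hv : v ≠ 0) (hw : w ≠ 0)
    (h : ∀ k < 3, ∀ i ≤ 6, ∫ x, asl μ u i x * gg k v c w e x ∂μ = 0) (i : ℕ) (hi : i ≤ 6) (b₁ b₂ : Bool) :
    μ (slab u (T μ u) 6 i ∩ halfSp v c b₁ ∩ halfSp w e b₂) = μ Set.univ / 28 := by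
  set B := slab u (T μ u) 6 i ∩ halfSp v c b₁ ∩ halfSp w e b₂ with hB
  have hBm : MeasurableSet B := ((slab_meas _ _ _ _).inter (halfSp_meas _ _ _)).inter (halfSp_meas _ _ _)
  have hitg : ∀ k, Integrable (fun x => asl μ u i x * gg k v c w e x) μ := fun k =>
    int_bdd ((asl_meas _ _ _).mul (gg_meas _ _ _ _ _)) fun x => abs_mul_le (asl_abs _ _ _ _) (gg_abs _ _ _ _ _ _)
  have hint0 : Integrable (asl μ u i) μ := int_bdd (asl_meas _ _ _) fun x => asl_abs _ _ _ _
  set σ₁ : ℝ := if b₁ then 1 else -1 with hσ₁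
  set σ₂ : ℝ := if b₂ then 1 else -1 with hσ₂
  have hr : μ.real B = μ.real Set.univ / 28 := by
    have h1 : μ.real B = ∫ x, B.indicator (fun _ => (1 : ℝ)) x ∂μ := by
      rw [integral_indicator_const _ hBm, smul_eq_mul, mul_one]
    have hae : ∀ᵐ x ∂μ, B.indicator (fun _ => (1 : ℝ)) x = 1 / 4 * asl μ u i x +
        (σ₁ / 4 * (asl μ u i x * gg 0 v c w e x) + (σ₂ / 4 * (asl μ u i x * gg 1 v c w e x) +
          σ₁ * σ₂ / 4 * (asl μ u i x * gg 2 v c w e x))) := by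
      filter_upwards [ae_ne hac v c (Or.inl hv), ae_ne hac w e (Or.inl hw)] with x h1 h2
      have e1 : B.indicator (fun _ => (1 : ℝ)) x = (slab u (T μ u) 6 i).indicator (fun _ => (1 : ℝ)) x *
          (halfSp v c b₁).indicator (fun _ => (1 : ℝ)) x * (halfSp w e b₂).indicator (fun _ => (1 : ℝ)) x := by
        classical
        simp only [hB, Set.indicator_apply, Set.mem_inter_iff]
        by_cases p1 : x ∈ slab u (T μ u) 6 i <;> by_cases p2 : x ∈ halfSp v c b₁ <;>
          by_cases p3 : x ∈ halfSp w e b₂ <;> simp [p1, p2, p3]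
      rw [e1, ← asl_ind, half_ind h1, half_ind h2]
      have g0 : gg 0 v c w e x = hs v c x := by simp [gg]
      have g1 : gg 1 v c w e x = hs w e x := by simp [gg]
      have g2 : gg 2 v c w e x = hs v c x * hs w e x := by simp [gg]
      rw [g0, g1, g2]
      ring
    have j0 := (hitg 0).const_mul (σ₁ / 4)
    have j1 := (hitg 1).const_mul (σ₂ / 4)
    have j2 := (hitg 2).const_mul (σ₁ * σ₂ / 4)
    have j12 : Integrable (fun x => σ₂ / 4 * (asl μ u i x * gg 1 v c w e x) +
          σ₁ * σ₂ / 4 * (asl μ u i x * gg 2 v c w e x)) μ := j1.add j2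
    have j012 : Integrable (fun x => σ₁ / 4 * (asl μ u i x * gg 0 v c w e x) +
        (σ₂ / 4 * (asl μ u i x * gg 1 v c w e x) +
          σ₁ * σ₂ / 4 * (asl μ u i x * gg 2 v c w e x))) μ := j0.add j12
    rw [h1, integral_congr_ae hae, integral_add (hint0.const_mul _) j012, integral_add j0 j12,
      integral_add j1 j2]
    simp only [integral_const_mul]
    rw [h 0 (by norm_num) i hi, h 1 (by norm_num) i hi, h 2 (by norm_num) i hi, int_asl hac hpos hu hi]
    ring
  rw [← ENNReal.toReal_eq_toReal_iff' (measure_ne_top _ _) (ENNReal.div_ne_top (measure_ne_top _ _) (by norm_num)),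
    ENNReal.toReal_div]
  exact hr

lemma half_nonconst (hac : μ ≪ volume)
    (hpos : ∀ U : Set E8, IsOpen U → U.Nonempty → 0 < μ U) {u : E8} (hu : u ≠ 0) {v : E8} {c : ℝ} (h : v ≠ 0 ∨ c ≠ 0)
    (h0 : ∫ x, asl μ u 0 x * hs v c x ∂μ = 0) : v ≠ 0 := by
  intro hv
  have hc : c ≠ 0 := h.resolve_left (fun h => h hv)
  have hM := M_pos hac hpos
  have : ∀ x, hs v c x = sg c := fun x => by simp [hs, hv]
  simp only [this] at h0
  rw [integral_mul_const, int_asl hac hpos hu (by norm_num)] at h0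
  rcases lt_or_gt_of_ne hc with h | h
  · rw [sg_of_neg h] at h0; linarith
  · rw [sg_pos h] at h0; linarith

theorem main_ac (hac : μ ≪ volume)
    (hpos : ∀ U : Set E8, IsOpen U → U.Nonempty → 0 < μ U) : ∃ (u v w : E8) (t : ℕ → ℝ) (s₁ s₂ : ℝ),
      ‖u‖ = 1 ∧ ‖v‖ = 1 ∧ ‖w‖ = 1 ∧
      v ≠ u ∧ v ≠ -u ∧ w ≠ u ∧ w ≠ -u ∧ w ≠ v ∧ w ≠ -v ∧
      StrictMonoOn t (Set.Icc 1 6) ∧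
      ∀ i ≤ 6, ∀ b₁ b₂ : Bool,
        μ (slab u t 6 i ∩ halfSp v s₁ b₁ ∩ halfSp w s₂ b₂) = μ Set.univ / 28 := by
  obtain ⟨p, hp, h⟩ := exists_zero hac hpos
  have hu := uE_ne hp.1
  have hv : vE p.2.1 ≠ 0 := half_nonconst hac hpos hu (vE_ne hp.2.1) (by
    have := h 0 (by norm_num) 0 (by norm_num)
    simpa [II, gg] using this)
  have hw : wE p.2.2 ≠ 0 := half_nonconst hac hpos hu (wE_ne hp.2.2) (by
    have := h 1 (by norm_num) 0 (by norm_num)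
    simpa [II, gg] using this)
  have hbox := box_meas hac hpos hu hv hw h
  have hpu : 0 < ‖uE p.1‖⁻¹ := inv_pos.2 (norm_pos_iff.2 hu)
  have hbox' : ∀ i ≤ 6, ∀ b₁ b₂ : Bool,
      μ (slab (‖uE p.1‖⁻¹ • uE p.1) (fun k => ‖uE p.1‖⁻¹ * T μ (uE p.1) k) 6 i ∩
        halfSp (‖vE p.2.1‖⁻¹ • vE p.2.1) (‖vE p.2.1‖⁻¹ * vc p.2.1) b₁ ∩
        halfSp (‖wE p.2.2‖⁻¹ • wE p.2.2) (‖wE p.2.2‖⁻¹ * wc p.2.2) b₂) = μ Set.univ / 28 := by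
    intro i hi b₁ b₂
    rw [slab_norm hu, half_norm hv, half_norm hw]
    exact hbox i hi b₁ b₂
  have hmono : StrictMonoOn (fun k => ‖uE p.1‖⁻¹ * T μ (uE p.1) k) (Set.Icc 1 6) := by
    intro k hk l hl hkl
    exact mul_lt_mul_of_pos_left (T_lt hac hpos hu hk.1 hkl hl.2) hpu
  have hnp := nonpar (hmono (by norm_num) (by norm_num) (by norm_num : (1 : ℕ) < 6)) (fun i hi b₁ b₂ => by
    apply nonempty_of_measure_ne_zero (μ := μ)
    rw [hbox' i hi b₁ b₂]
    exact ENNReal.div_ne_zero.2 ⟨(hpos _ isOpen_univ Set.univ_nonempty).ne', by norm_num⟩)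
  obtain ⟨n1, n2, n3, n4, n5, n6⟩ := hnp
  exact ⟨_, _, _, _, _, _, norm_one hu, norm_one hv, norm_one hw, n1, n2, n3, n4, n5, n6, hmono, hbox'⟩

end EqBox

/-- Every mass distribution in `ℝ^8` admits an equipartition into `28` boxes
by a collection of `6` parallel hyperplanes and two additional non-parallel
hyperplanes. -/
theorem equipartition_R8_28_boxes
    (μ : Measure (EuclideanSpace ℝ (Fin 8)))
    (f : EuclideanSpace ℝ (Fin 8) → ℝ) (hf : Integrable f)
    (hμ : ∀ A : Set (EuclideanSpace ℝ (Fin 8)), MeasurableSet A →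
      μ A = ENNReal.ofReal (∫ x in A, f x))
    (hpos : ∀ U : Set (EuclideanSpace ℝ (Fin 8)), IsOpen U → U.Nonempty → 0 < μ U) :
    ∃ (u v w : EuclideanSpace ℝ (Fin 8)) (t : ℕ → ℝ) (s₁ s₂ : ℝ),
      ‖u‖ = 1 ∧ ‖v‖ = 1 ∧ ‖w‖ = 1 ∧
      v ≠ u ∧ v ≠ -u ∧ w ≠ u ∧ w ≠ -u ∧ w ≠ v ∧ w ≠ -v ∧
      StrictMonoOn t (Set.Icc 1 6) ∧
      ∀ i ≤ 6, ∀ b₁ b₂ : Bool,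
        μ (slab u t 6 i ∩ halfSp v s₁ b₁ ∩ halfSp w s₂ b₂) =
          μ Set.univ / 28 := by
  haveI : IsFiniteMeasure μ := ⟨by rw [hμ _ MeasurableSet.univ]; exact ENNReal.ofReal_lt_top⟩
  have hac : μ ≪ volume := by
    refine Measure.AbsolutelyContinuous.mk fun A hA h0 => ?_
    rw [hμ A hA, setIntegral_measure_zero f h0, ENNReal.ofReal_zero]
  exact EqBox.main_ac hac hpos
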